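/- (Berestycki–Lions existence theorem) Let d ≥ 3 and let g : ℝ → ℝ be an odd continuous function with g(0) = 0 satisfying: (1) -∞ < liminf_{s→0⁺} g(s)/s ≤ limsup_{s→0⁺} g(s)/s = -m for some m > 0; (2) limsup_{s→+∞} g(s)/s^l ≤ 0 (the limsup being allowed to be -∞), where l = (d+2)/(d-2); (3) there exists ζ > 0 with G(ζ) := ∫₀^ζ g(σ) dσ > 0. Then there exists a nontrivial function v : ℝ^d → ℝ such that: (i) v(x) > 0 for all x ∈ ℝ^d; (ii) v is spherically symmetric, i.e. v(x) = w(|x|) for a function w that is decreasing on [0,∞); (iii) v is twice continuously differentiable and satisfies -Δv(x) = g(v(x)) for all x ∈ ℝ^d; (iv) there exist constants C, δ > 0 such that |∂^α v(x)| ≤ C e^{-δ|x|} for all x ∈ ℝ^d and all multi-indices α with |α| ≤ 2. -/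

import Mathlib

open MeasureTheory Filter
open scoped ENNReal

noncomputable section

/-- `d`-dimensional Euclidean space. -/
abbrev Ed (d : ℕ) := EuclideanSpace ℝ (Fin d)

/-- The Laplacian `Δf(x) = Σ_{i=1}^d ∂²f/∂x_i²(x)` of a real-valued function. -/
def lap (d : ℕ) (f : Ed d → ℝ) (x : Ed d) : ℝ :=
  ∑ i : Fin d, fderiv ℝ (fun y => fderiv ℝ f y (EuclideanSpace.single i 1)) x
    (EuclideanSpace.single i 1)

/-- Squared norm of the gradient: `|∇f(x)|² = Σ_{i=1}^d (∂f/∂x_i)(x)²`. -/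
def gradSq (d : ℕ) (f : Ed d → ℝ) (x : Ed d) : ℝ :=
  ∑ i : Fin d, (fderiv ℝ f x (EuclideanSpace.single i 1)) ^ 2

namespace BerestyckiLions
open Set Topology

/-- The structural hypotheses on the (truncated) nonlinearity. The exponent `k` is the one of the
equation `u'' = -λ t⁻ᵏ h(u)` obtained from the radial equation in the variable `t = r^(2-d)`; then
`2 * k - 3` is the critical exponent `(d + 2) / (d - 2)`. -/
structure Nonlinearity (k : ℝ) (h : ℝ → ℝ) : Prop where
  cont : Continuous h
  zero : ∀ s ≤ 0, h s = 0
  near : ∃ s₀ > 0, ∃ c > 0, ∃ K, ∀ s, 0 ≤ s → s ≤ s₀ → -(K * s) ≤ h s ∧ h s ≤ -(c * s)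
  growth : ∀ ε > 0, ∃ C, ∀ s, 0 ≤ s → h s ≤ ε * s ^ (2 * k - 3) + C
  large : ∃ s₁, ∀ s ≥ s₁, 0 ≤ h s
  pos : ∃ ζ > 0, 0 < ∫ σ in (0 : ℝ)..ζ, h σ

/-- Nontrivial solutions of `u'' = -λ t⁻ᵏ h(u)` on `(0, ∞)` which are `O(√t)`. -/
structure Solution (k lam : ℝ) (h u u' : ℝ → ℝ) : Prop where
  zero : u 0 = 0
  deriv : ∀ t > 0, HasDerivAt u (u' t) t
  deriv' : ∀ t > 0, HasDerivAt u' (-(lam * t ^ (-k) * h (u t))) t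
  bound : ∃ C, ∀ t > 0, |u t| ≤ C * √t
  nontrivial : ∃ t > 0, u t ≠ 0

lemma exists_sqrt_lt_linear {c : ℝ} (hc : 0 < c) (C D T : ℝ) :
    ∃ t > T, 0 < t ∧ C * √t + D < c * t := by
  set x := (|C| + |D| + 1) / c + |T| + 1 with hx
  have h1 : 0 < (|C| + |D| + 1) / c := by positivity
  have hx1 : 1 ≤ x := by have := abs_nonneg T; linarith
  have hxT : T < x := by have := le_abs_self T; linarith
  have hcx : |C| + |D| + 1 < c * x := by
    have : (|C| + |D| + 1) = c * ((|C| + |D| + 1) / c) := by field_simp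
    rw [this]
    have := abs_nonneg T
    gcongr
    linarith
  refine ⟨x ^ 2, by nlinarith, by positivity, ?_⟩
  rw [Real.sqrt_sq (by linarith)]
  have h2 := le_abs_self C
  have h3 := le_abs_self D
  nlinarith [abs_nonneg D, abs_nonneg C]

lemma antitoneOn_of_hasDerivAt {f f' : ℝ → ℝ} {D : Set ℝ} (hD : Convex ℝ D)
    (hc : ContinuousOn f D) (hd : ∀ x ∈ interior D, HasDerivAt f (f' x) x)
    (h : ∀ x ∈ interior D, f' x ≤ 0) : AntitoneOn f D :=
  antitoneOn_of_hasDerivWithinAt_nonpos hD hc (fun x hx => (hd x hx).hasDerivWithinAt) h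

lemma monotoneOn_of_hasDerivAt {f f' : ℝ → ℝ} {D : Set ℝ} (hD : Convex ℝ D)
    (hc : ContinuousOn f D) (hd : ∀ x ∈ interior D, HasDerivAt f (f' x) x)
    (h : ∀ x ∈ interior D, 0 ≤ f' x) : MonotoneOn f D :=
  monotoneOn_of_hasDerivWithinAt_nonneg hD hc (fun x hx => (hd x hx).hasDerivWithinAt) h

/-- A function with derivative at most `c` past `a` lies below the corresponding line. -/
lemma le_linear_of_hasDerivAt_le {f f' : ℝ → ℝ} {a c : ℝ}
    (hd : ∀ x ≥ a, HasDerivAt f (f' x) x) (h : ∀ x ≥ a, f' x ≤ c) {t : ℝ} (ht : a ≤ t) :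
    f t ≤ f a + c * (t - a) := by
  have : AntitoneOn (fun x => f x - c * x) (Ici a) := by
    refine antitoneOn_of_hasDerivAt (f' := fun x => f' x - c) (convex_Ici a) ?_ ?_ ?_
    · intro x hx
      exact (((hd x hx).continuousAt).sub (by fun_prop)).continuousWithinAt
    · intro x hx
      rw [interior_Ici] at hx
      simpa using (hd x hx.out.le).fun_sub ((hasDerivAt_id x).const_mul c)
    · intro x hx
      rw [interior_Ici] at hx
      have := h x hx.out.le
      linarith
  have := this (mem_Ici.2 le_rfl) (mem_Ici.2 ht) ht
  simp only at this
  linarith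

/-- A maximum principle on the half line. -/
lemma nonneg_of_concave_where_neg {f f₁ f₂ : ℝ → ℝ} (hcont : ContinuousOn f (Ici 0))
    (h0 : 0 ≤ f 0) (hf : ∀ t > 0, HasDerivAt f (f₁ t) t) (hf₁ : ∀ t > 0, HasDerivAt f₁ (f₂ t) t)
    (hneg : ∀ t > 0, f t < 0 → f₂ t ≤ 0) (hb : ∃ C D, ∀ t > 0, -(C * √t + D) ≤ f t) :
    ∀ t ≥ 0, 0 ≤ f t := by
  by_contra! hcon
  obtain ⟨t0, ht0', hft0⟩ := hcon
  have ht0 : 0 < t0 := lt_of_le_of_ne ht0' (by rintro rfl; linarith)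
  obtain ⟨t1, ht1, hft1, hf1t1⟩ : ∃ t1 > 0, f t1 < 0 ∧ f₁ t1 < 0 := by
    have hS : IsCompact (Icc 0 t0 ∩ f ⁻¹' Ici 0) := by
      refine IsCompact.of_isClosed_subset isCompact_Icc ?_ inter_subset_left
      exact (hcont.mono Icc_subset_Ici_self).preimage_isClosed_of_isClosed isClosed_Icc isClosed_Ici
    obtain ⟨a, ⟨⟨ha0, hat⟩, hfa⟩, hmax⟩ := hS.exists_isGreatest ⟨0, ⟨le_rfl, ht0'⟩, h0⟩
    have hfa : 0 ≤ f a := hfa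
    have hat' : a < t0 := lt_of_le_of_ne hat (by rintro rfl; linarith)
    obtain ⟨c, hc, hfc⟩ := exists_hasDerivAt_eq_slope f f₁ hat'
      (hcont.mono fun x hx => ha0.trans hx.1) (fun x hx => hf x (ha0.trans_lt hx.1))
    refine ⟨c, ha0.trans_lt hc.1, ?_, ?_⟩
    · by_contra! h
      exact absurd (hmax ⟨⟨ha0.trans hc.1.le, hc.2.le⟩, h⟩) (not_le.2 hc.1)
    · rw [hfc]
      exact div_neg_of_neg_of_pos (by linarith) (by linarith)
  have hcont1 : ContinuousOn f₁ (Ici t1) := fun x hx =>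
    (hf₁ x (ht1.trans_le hx)).continuousAt.continuousWithinAt
  have hcont0 : ContinuousOn f (Ici t1) := hcont.mono (Ici_subset_Ici.2 ht1.le)
  have key : ∀ t ≥ t1, f t < 0 := by
    by_contra! hcon
    obtain ⟨t2, ht2, hft2⟩ := hcon
    have hS : IsCompact (Icc t1 t2 ∩ f ⁻¹' Ici 0) := by
      refine IsCompact.of_isClosed_subset isCompact_Icc ?_ inter_subset_left
      exact (hcont0.mono Icc_subset_Ici_self).preimage_isClosed_of_isClosed
        isClosed_Icc isClosed_Ici
    obtain ⟨b, ⟨⟨hb1, hb2⟩, hfb⟩, hmin⟩ := hS.exists_isLeast ⟨t2, ⟨ht2, le_rfl⟩, hft2⟩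
    have hfb : 0 ≤ f b := hfb
    have hlt : ∀ s ∈ Ioo t1 b, f s < 0 := fun s hs => by
      by_contra! h
      exact absurd (hmin ⟨⟨hs.1.le, hs.2.le.trans hb2⟩, h⟩) (not_le.2 hs.2)
    have hanti : AntitoneOn f₁ (Icc t1 b) := by
      refine antitoneOn_of_hasDerivAt (f' := f₂) (convex_Icc _ _)
        (hcont1.mono Icc_subset_Ici_self) ?_ ?_ <;> rw [interior_Icc]
      · exact fun x hx => hf₁ x (ht1.trans hx.1)
      · exact fun x hx => hneg x (ht1.trans hx.1) (hlt x hx)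
    have hanti' : AntitoneOn f (Icc t1 b) := by
      refine antitoneOn_of_hasDerivAt (f' := f₁) (convex_Icc _ _)
        (hcont0.mono Icc_subset_Ici_self) ?_ ?_ <;> rw [interior_Icc]
      · exact fun x hx => hf x (ht1.trans hx.1)
      · exact fun x hx => (hanti ⟨le_rfl, hb1⟩ (Ioo_subset_Icc_self hx) hx.1.le).trans hf1t1.le
    have := hanti' ⟨le_rfl, hb1⟩ ⟨hb1, le_rfl⟩ hb1
    linarith
  have hanti : AntitoneOn f₁ (Ici t1) := by
    refine antitoneOn_of_hasDerivAt (f' := f₂) (convex_Ici _) hcont1 ?_ ?_ <;> rw [interior_Ici]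
    · exact fun x hx => hf₁ x (ht1.trans hx)
    · exact fun x hx => hneg x (ht1.trans hx) (key x (le_of_lt hx))
  obtain ⟨C, D, hb⟩ := hb
  obtain ⟨t, htT, ht, hlt⟩ := exists_sqrt_lt_linear (neg_pos.2 hf1t1) C (D + f t1 - f₁ t1 * t1) t1
  have h1 := le_linear_of_hasDerivAt_le (c := f₁ t1) (fun x hx => hf x (ht1.trans_le hx))
    (fun x hx => hanti (mem_Ici.2 le_rfl) hx hx) htT.le
  have h2 := hb t ht
  nlinarith

namespace Solution
variable {k lam : ℝ} {h u u' : ℝ → ℝ}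

lemma continuousOn (hs : Solution k lam h u u') : ContinuousOn u (Ici 0) := by
  intro t ht
  rcases eq_or_lt_of_le (mem_Ici.1 ht) with rfl | ht
  · obtain ⟨C, hC⟩ := hs.bound
    rw [ContinuousWithinAt, hs.zero]
    refine squeeze_zero_norm' (a := fun t => C * √t) ?_ ?_
    · filter_upwards [self_mem_nhdsWithin] with t ht
      rcases eq_or_lt_of_le (mem_Ici.1 ht) with rfl | ht
      · simp [hs.zero]
      · exact hC t ht
    · have : ContinuousAt (fun t => C * √t) 0 := by fun_prop
      simpa using this.continuousWithinAt.tendsto (s := Ici 0)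
  · exact (hs.deriv t ht).continuousAt.continuousWithinAt

lemma nonneg (hs : Solution k lam h u u') (hh : Nonlinearity k h) : ∀ t ≥ 0, 0 ≤ u t := by
  obtain ⟨C, hC⟩ := hs.bound
  refine nonneg_of_concave_where_neg hs.continuousOn hs.zero.ge hs.deriv hs.deriv' ?_ ⟨C, 0, ?_⟩
  · intro t ht hut
    simp [hh.zero _ hut.le]
  · intro t ht
    have := neg_le_of_abs_le (hC t ht)
    linarith

lemma le_of_nonpos_above (hs : Solution k lam h u u') (hlam : 0 < lam) {s : ℝ} (hs0 : 0 ≤ s)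
    (hh : ∀ σ ≥ s, h σ ≤ 0) : ∀ t ≥ 0, u t ≤ s := by
  obtain ⟨C, hC⟩ := hs.bound
  have := nonneg_of_concave_where_neg (f := fun t => s - u t) (f₁ := fun t => - u' t)
    (f₂ := fun t => lam * t ^ (-k) * h (u t)) (continuousOn_const.sub hs.continuousOn)
    (by simpa [hs.zero]) (fun t ht => by simpa using (hs.deriv t ht).const_sub s)
    (fun t ht => by simpa using (hs.deriv' t ht).fun_neg) ?_ ⟨C, -s, ?_⟩
  · intro t ht
    linarith [this t ht]
  · intro t ht hlt
    exact mul_nonpos_of_nonneg_of_nonpos (by positivity) (hh _ (by linarith))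
  · intro t ht
    have := le_of_abs_le (hC t ht)
    linarith

end Solution

lemma hasDerivAt_const_mul_rpow (c p : ℝ) {t : ℝ} (ht : 0 < t) :
    HasDerivAt (fun t : ℝ => c * t ^ p) (c * p * t ^ (p - 1)) t := by
  have := (Real.hasDerivAt_rpow_const (x := t) (p := p) (Or.inl ht.ne')).const_mul c
  rwa [← mul_assoc] at this

lemma tendsto_const_mul_rpow_atTop (c : ℝ) {p : ℝ} (hp : p < 0) :
    Tendsto (fun t : ℝ => c * t ^ p) atTop (𝓝 0) := by
  have := (tendsto_rpow_neg_atTop (neg_pos.2 hp)).const_mul c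
  simpa using this

lemma Nonlinearity.exists_lower_bound {k : ℝ} {h : ℝ → ℝ} (hh : Nonlinearity k h) :
    ∃ M ≥ 0, ∀ s, -M ≤ h s := by
  obtain ⟨s₁, hs₁⟩ := hh.large
  obtain ⟨m, hm⟩ := (isCompact_Icc (a := 0) (b := s₁)).bddBelow_image hh.cont.continuousOn
  refine ⟨|m|, abs_nonneg m, fun s => ?_⟩
  rcases le_total s 0 with h0 | h0
  · simp [hh.zero s h0]
  rcases le_total s s₁ with h1 | h1
  · exact (neg_abs_le m).trans (hm (mem_image_of_mem h ⟨h0, h1⟩))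
  · linarith [hs₁ s h1, abs_nonneg m]

/-- Comparison from infinity with a sum of powers less than one. -/
lemma le_sum_rpow_of_deriv2 {u u' u₂ : ℝ → ℝ} (hu : ∀ t ≥ 1, HasDerivAt u (u' t) t)
    (hu' : ∀ t ≥ 1, HasDerivAt u' (u₂ t) t) (hlim : Tendsto u' atTop (𝓝 0))
    {p q r a b c : ℝ} (hp : p < 1) (hq : q < 1) (hr : r < 1)
    (hle : ∀ t ≥ 1, a * p * (p - 1) * t ^ (p - 2) + b * q * (q - 1) * t ^ (q - 2)
      + c * r * (r - 1) * t ^ (r - 2) ≤ u₂ t) :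
    ∀ t ≥ 1, u t ≤ u 1 - (a + b + c) + (a * t ^ p + b * t ^ q + c * t ^ r) := by
  have hpos : ∀ t : ℝ, t ≥ 1 → 0 < t := fun t ht => lt_of_lt_of_le one_pos ht
  set E : ℝ → ℝ := fun t => a * t ^ p + b * t ^ q + c * t ^ r with hE
  set E₁ : ℝ → ℝ := fun t => a * p * t ^ (p - 1) + b * q * t ^ (q - 1) + c * r * t ^ (r - 1)
  have hdE : ∀ t ≥ 1, HasDerivAt E (E₁ t) t := fun t ht =>
    ((hasDerivAt_const_mul_rpow a p (hpos t ht)).fun_add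
      (hasDerivAt_const_mul_rpow b q (hpos t ht))).fun_add
      (hasDerivAt_const_mul_rpow c r (hpos t ht))
  have hdE₁ : ∀ t ≥ 1, HasDerivAt E₁ (a * p * (p - 1) * t ^ (p - 2)
      + b * q * (q - 1) * t ^ (q - 2) + c * r * (r - 1) * t ^ (r - 2)) t := fun t ht => by
    have := ((hasDerivAt_const_mul_rpow (a * p) (p - 1) (hpos t ht)).fun_add
      (hasDerivAt_const_mul_rpow (b * q) (q - 1) (hpos t ht))).fun_add
      (hasDerivAt_const_mul_rpow (c * r) (r - 1) (hpos t ht))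
    simpa only [sub_sub, one_add_one_eq_two] using this
  have hE₁lim : Tendsto E₁ atTop (𝓝 0) := by
    have := ((tendsto_const_mul_rpow_atTop (a * p) (p := p - 1) (by linarith)).add
      (tendsto_const_mul_rpow_atTop (b * q) (p := q - 1) (by linarith))).add
      (tendsto_const_mul_rpow_atTop (c * r) (p := r - 1) (by linarith))
    simpa using this
  have hmono : MonotoneOn (fun t => u' t - E₁ t) (Ici 1) := by
    refine monotoneOn_of_hasDerivAt (convex_Ici 1)
      (fun t ht => ((hu' t ht).continuousAt.sub (hdE₁ t ht).continuousAt).continuousWithinAt)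
      (fun t ht => ?_) (f' := fun t => u₂ t - (a * p * (p - 1) * t ^ (p - 2)
      + b * q * (q - 1) * t ^ (q - 2) + c * r * (r - 1) * t ^ (r - 2))) (fun t ht => ?_)
    · rw [interior_Ici] at ht
      exact (hu' t (le_of_lt ht)).fun_sub (hdE₁ t (le_of_lt ht))
    · rw [interior_Ici] at ht
      exact sub_nonneg.2 (hle t (le_of_lt ht))
  have hle' : ∀ t ≥ 1, u' t - E₁ t ≤ 0 := fun t ht => by
    have hl : Tendsto (fun t => u' t - E₁ t) atTop (𝓝 0) := by simpa using hlim.sub hE₁lim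
    refine ge_of_tendsto hl ?_
    filter_upwards [eventually_ge_atTop t] with s hs
    exact hmono ht (ht.trans hs) hs
  have hanti : AntitoneOn (fun t => u t - E t) (Ici 1) := by
    refine antitoneOn_of_hasDerivAt (convex_Ici 1)
      (fun t ht => ((hu t ht).continuousAt.sub (hdE t ht).continuousAt).continuousWithinAt)
      (fun t ht => ?_) (f' := fun t => u' t - E₁ t) (fun t ht => ?_)
    · rw [interior_Ici] at ht
      exact (hu t (le_of_lt ht)).fun_sub (hdE t (le_of_lt ht))
    · rw [interior_Ici] at ht
      exact hle' t (le_of_lt ht)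
  intro t ht
  have := hanti (mem_Ici.2 le_rfl) ht ht
  simp only [hE, Real.one_rpow, mul_one] at this
  linarith

namespace Solution
variable {k lam : ℝ} {h u u' : ℝ → ℝ}

lemma tendsto_deriv_atTop (hs : Solution k lam h u u') (hh : Nonlinearity k h) (hk : 2 < k)
    (hlam : 0 < lam) : Tendsto u' atTop (𝓝 0) := by
  obtain ⟨M, hM0, hM⟩ := hh.exists_lower_bound
  obtain ⟨C, hC⟩ := hs.bound
  set c := lam * M / (k - 1) with hc
  have hk1 : 0 < k - 1 := by linarith
  have hc0 : 0 ≤ c := by positivity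
  set A : ℝ → ℝ := fun t => u' t + c * t ^ (1 - k) with hA
  have hdA : ∀ t > 0, HasDerivAt A (-(lam * t ^ (-k) * (h (u t) + M))) t := fun t ht => by
    refine ((hs.deriv' t ht).fun_add (hasDerivAt_const_mul_rpow c (1 - k) ht)).congr_deriv ?_
    rw [hc, show 1 - k - 1 = -k by ring]
    field_simp
    ring
  have hanti : AntitoneOn A (Ioi 0) := by
    refine antitoneOn_of_hasDerivAt (convex_Ioi 0)
      (fun t ht => (hdA t ht).continuousAt.continuousWithinAt) (fun t ht => ?_)
      (f' := fun t => -(lam * t ^ (-k) * (h (u t) + M))) (fun t ht => ?_)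
    · rw [interior_Ioi] at ht; exact hdA t ht
    · rw [interior_Ioi] at ht
      have ht : 0 < t := ht
      have : 0 ≤ h (u t) + M := by linarith [hM (u t)]
      have : 0 ≤ lam * t ^ (-k) * (h (u t) + M) := by positivity
      linarith
  have hAu : ∀ t > 0, u' t ≤ A t := fun t ht => by
    have : 0 ≤ c * t ^ (1 - k) := by positivity
    simp only [hA]; linarith
  have hA0 : ∀ t > 0, 0 ≤ A t := by
    by_contra! hcon
    obtain ⟨t0, ht0, hneg⟩ := hcon
    obtain ⟨t, htT, ht, hlt⟩ := exists_sqrt_lt_linear (neg_pos.2 hneg) 0 (u t0 - A t0 * t0) t0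
    have h1 := le_linear_of_hasDerivAt_le (c := A t0)
      (fun x hx => hs.deriv x (lt_of_lt_of_le ht0 hx))
      (fun x hx => (hAu x (lt_of_lt_of_le ht0 hx)).trans
        (hanti ht0 (lt_of_lt_of_le ht0 hx) hx)) htT.le
    have := hs.nonneg hh t ht.le
    nlinarith
  have hAsmall : ∀ ε > 0, ∃ t > 0, A t < ε := by
    by_contra! hcon
    obtain ⟨ε, hε, hge⟩ := hcon
    have := (tendsto_const_mul_rpow_atTop c (p := 1 - k) (by linarith)).eventually_lt_const
      (half_pos hε)
    obtain ⟨T, hT⟩ := eventually_atTop.1 (this.and (eventually_gt_atTop 0))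
    have hT0 : ∀ x ≥ T, 0 < x := fun x hx => (hT x hx).2
    obtain ⟨t, htT, ht, hlt⟩ := exists_sqrt_lt_linear (half_pos hε) C (-u T + ε / 2 * T) T
    have h1 := le_linear_of_hasDerivAt_le (f := fun t => -u t) (f' := fun t => - u' t)
      (c := -(ε / 2)) (fun x hx => (hs.deriv x (hT0 x hx)).fun_neg)
      (fun x hx => by
        have h1 := hge x (hT0 x hx)
        have h2 := (hT x hx).1
        simp only [hA] at h1
        linarith) htT.le
    have := le_of_abs_le (hC t ht)
    nlinarith
  have hAlim : Tendsto A atTop (𝓝 0) := by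
    refine Metric.tendsto_atTop.2 fun ε hε => ?_
    obtain ⟨t, ht, hlt⟩ := hAsmall ε hε
    refine ⟨t, fun s hs => ?_⟩
    have hs0 : 0 < s := lt_of_lt_of_le ht hs
    rw [Real.dist_eq, sub_zero, abs_of_nonneg (hA0 s hs0)]
    exact (hanti ht hs0 hs).trans_lt hlt
  have := hAlim.sub (tendsto_const_mul_rpow_atTop c (p := 1 - k) (by linarith))
  simpa [hA] using this

/-- A solution grows at most like a small power of `t`. -/
lemma exists_le_rpow (hs : Solution k lam h u u') (hh : Nonlinearity k h) (hk : 2 < k)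
    (hlam : 0 < lam) {β : ℝ} (hβ : 0 < β) (hβ1 : β < 1) :
    ∃ B ≥ 0, ∀ t ≥ 1, u t ≤ B * t ^ β := by
  obtain ⟨C', hC'⟩ := hs.bound
  set C := max C' 1 with hCdef
  have hC1 : 1 ≤ C := le_max_right _ _
  have hC : ∀ t > 0, u t ≤ C * t ^ (1 / 2 : ℝ) := fun t ht => by
    rw [← Real.sqrt_eq_rpow]
    exact (le_of_abs_le (hC' t ht)).trans
      (mul_le_mul_of_nonneg_right (le_max_left _ _) (Real.sqrt_nonneg t))
  have hu0 : ∀ t > 0, 0 ≤ u t := fun t ht => hs.nonneg hh t (le_of_lt ht)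
  set κ := min (β * (1 - β) / 2) (1 / 8) with hκ
  have h1β : 0 < 1 - β := by linarith
  have hκ0 : 0 < κ := by positivity
  have hκ1 : κ / (β * (1 - β)) ≤ 1 / 2 := by
    rw [div_le_iff₀ (by positivity)]
    linarith [min_le_left (β * (1 - β) / 2) (1 / 8)]
  have hκ2 : κ ≤ 1 / 8 := min_le_right _ _
  have hD : 0 < lam * C ^ (2 * k - 4) := by positivity
  obtain ⟨K', hK'⟩ := hh.growth (κ / (lam * C ^ (2 * k - 4))) (by positivity)
  set K := max K' 0
  have hK0 : 0 ≤ K := le_max_right _ _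
  have hK : ∀ s, 0 ≤ s → h s ≤ κ / (lam * C ^ (2 * k - 4)) * s ^ (2 * k - 3) + K :=
    fun s hs => (hK' s hs).trans (by gcongr; exact le_max_left _ _)
  have hk1 : 0 < k - 1 := by linarith
  have hk2 : 0 < k - 2 := by linarith
  have hpoint : ∀ t > 0, lam * t ^ (-k) * h (u t) ≤ κ * (t ^ (-2 : ℝ) * u t)
      + lam * K * t ^ (-k) := fun t ht => by
    have h1 : u t ^ (2 * k - 3) ≤ u t * (C ^ (2 * k - 4) * t ^ (k - 2)) := by
      rw [show 2 * k - 3 = 1 + (2 * k - 4) by ring,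
        Real.rpow_add_of_nonneg (hu0 t ht) zero_le_one (by linarith), Real.rpow_one]
      refine mul_le_mul_of_nonneg_left ?_ (hu0 t ht)
      refine (Real.rpow_le_rpow (hu0 t ht) (hC t ht) (by linarith)).trans_eq ?_
      rw [Real.mul_rpow (by linarith) (by positivity), ← Real.rpow_mul ht.le]
      congr 2; ring
    calc lam * t ^ (-k) * h (u t)
        ≤ lam * t ^ (-k) * (κ / (lam * C ^ (2 * k - 4)) *
            (u t * (C ^ (2 * k - 4) * t ^ (k - 2))) + K) := by
          have := hK (u t) (hu0 t ht)
          gcongr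
          exact this.trans (by gcongr)
      _ = κ * ((t ^ (-k) * t ^ (k - 2)) * u t) + lam * K * t ^ (-k) := by
          field_simp
      _ = _ := by rw [← Real.rpow_add ht]; congr 4; ring
  set C1 := lam * K with hC1def
  have hC10 : 0 ≤ C1 := by positivity
  set B := 2 * (u 1 + C1 / ((k - 1) * (k - 2))) with hB
  have hB0 : 0 ≤ B := by have := hu0 1 one_pos; positivity
  refine ⟨B, hB0, ?_⟩
  have hiter : ∀ n : ℕ, ∀ t ≥ 1, u t ≤ B * t ^ β + C / 2 ^ n * t ^ (1 / 2 : ℝ) := by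
    intro n
    induction n with
    | zero =>
      intro t ht
      have ht0 : 0 < t := by linarith
      have := hC t ht0
      have : 0 ≤ B * t ^ β := by positivity
      simp only [pow_zero, div_one]; linarith
    | succ n ih =>
      have hmain := le_sum_rpow_of_deriv2 (fun t ht => hs.deriv t (by linarith))
        (fun t ht => hs.deriv' t (by linarith)) (hs.tendsto_deriv_atTop hh hk hlam)
        (p := β) (q := 1 / 2) (r := 2 - k) (a := κ * B / (β * (1 - β))) (b := 4 * κ * (C / 2 ^ n))
        (c := - (C1 / ((k - 1) * (k - 2)))) hβ1 (by norm_num) (by linarith) ?_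
      · intro t ht
        have ht0 : 0 < t := by linarith
        have h1 := hmain t ht
        have h2 : 0 ≤ κ * B / (β * (1 - β)) := by positivity
        have h3 : 0 ≤ 4 * κ * (C / 2 ^ n) := by positivity
        have h4 : 0 ≤ C1 / ((k - 1) * (k - 2)) := by positivity
        have h5 : 0 ≤ C1 / ((k - 1) * (k - 2)) * t ^ (2 - k) := by positivity
        have h6 : κ * B / (β * (1 - β)) * t ^ β ≤ B / 2 * t ^ β := by
          have : κ * B / (β * (1 - β)) = κ / (β * (1 - β)) * B := by ring
          rw [this]
          gcongr
          nlinarith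
        have h7 : 4 * κ * (C / 2 ^ n) * t ^ (1 / 2 : ℝ) ≤ C / 2 ^ (n + 1) * t ^ (1 / 2 : ℝ) := by
          gcongr
          rw [pow_succ, ← div_div]
          have : 0 ≤ C / 2 ^ n := by positivity
          nlinarith
        have h8 : B / 2 ≤ B / 2 * t ^ β :=
          le_mul_of_one_le_right (by positivity) (Real.one_le_rpow ht hβ.le)
        have h9 : B / 2 = u 1 + C1 / ((k - 1) * (k - 2)) := by rw [hB]; ring
        linarith
      · intro t ht
        have ht0 : 0 < t := by linarith
        have h1 := hpoint t ht0
        have h2 : t ^ (-2 : ℝ) * u t ≤ B * t ^ (β - 2) + C / 2 ^ n * t ^ (1 / 2 - 2 : ℝ) := by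
          calc t ^ (-2 : ℝ) * u t
              ≤ t ^ (-2 : ℝ) * (B * t ^ β + C / 2 ^ n * t ^ (1 / 2 : ℝ)) := by
                gcongr; exact ih t ht
            _ = B * (t ^ β * t ^ (-2 : ℝ)) + C / 2 ^ n * (t ^ (1 / 2 : ℝ) * t ^ (-2 : ℝ)) := by
                ring
            _ = _ := by rw [← Real.rpow_add ht0, ← Real.rpow_add ht0]; rfl
        have h3 : κ * B / (β * (1 - β)) * β * (β - 1) = - (κ * B) := by
          field_simp
          ring
        have h4 : - (C1 / ((k - 1) * (k - 2))) * (2 - k) * (2 - k - 1) = - C1 := by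
          field_simp
          ring
        rw [h3, h4, show 2 - k - 2 = -k by ring]
        have h5 := mul_le_mul_of_nonneg_left h2 hκ0.le
        linarith
  intro t ht
  have ht0 : 0 < t := by linarith
  have hl : Tendsto (fun n : ℕ => B * t ^ β + C / 2 ^ n * t ^ (1 / 2 : ℝ)) atTop
      (𝓝 (B * t ^ β + 0 * t ^ (1 / 2 : ℝ))) := by
    refine tendsto_const_nhds.add (Tendsto.mul_const _ ?_)
    exact tendsto_const_nhds.div_atTop (tendsto_pow_atTop_atTop_of_one_lt one_lt_two)
  have := ge_of_tendsto' hl (fun n => hiter n t ht)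
  simpa using this

lemma bounded (hs : Solution k lam h u u') (hh : Nonlinearity k h) (hk : 2 < k)
    (hlam : 0 < lam) : ∃ B ≥ 0, ∀ t ≥ 0, u t ≤ B := by
  have hk3 : 0 < 2 * k - 3 := by linarith
  set β := (k - 2) / (2 * (2 * k - 3)) with hβ
  have hβ0 : 0 < β := div_pos (by linarith) (by linarith)
  have hβ1 : β < 1 := by rw [hβ, div_lt_one (by linarith)]; linarith
  have hβk : β * (2 * k - 3) = (k - 2) / 2 := by
    rw [hβ, ← div_div, div_mul_cancel₀ _ hk3.ne']
  obtain ⟨B, hB0, hB⟩ := hs.exists_le_rpow hh hk hlam hβ0 hβ1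
  obtain ⟨C, hC⟩ := hs.bound
  obtain ⟨K', hK'⟩ := hh.growth 1 one_pos
  set K := max K' 0
  have hK0 : 0 ≤ K := le_max_right _ _
  have hu0 : ∀ t > 0, 0 ≤ u t := fun t ht => hs.nonneg hh t (le_of_lt ht)
  set D := lam * (B ^ (2 * k - 3) + K) with hD
  have hD0 : 0 ≤ D := by positivity
  set a := D / ((k / 2) * (k / 2 - 1)) with ha
  have hk2 : 0 < k / 2 - 1 := by linarith
  have ha0 : 0 ≤ a := by positivity
  have hmain := le_sum_rpow_of_deriv2 (fun t ht => hs.deriv t (by linarith))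
        (fun t ht => hs.deriv' t (by linarith)) (hs.tendsto_deriv_atTop hh hk hlam)
        (p := 1 - k / 2) (q := 0) (r := 0) (a := - a) (b := 0)
        (c := 0) (by linarith) (by norm_num) (by linarith) ?_
  · refine ⟨max |C| (u 1 + a), by positivity, fun t ht => ?_⟩
    rcases le_total t 1 with h1 | h1
    · rcases eq_or_lt_of_le ht with rfl | ht
      · rw [hs.zero]; positivity
      refine le_trans ?_ (le_max_left _ _)
      refine (le_of_abs_le (hC t ht)).trans ?_
      calc C * √t ≤ |C| * 1 := by
            gcongr
            · exact le_abs_self C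
            · exact Real.sqrt_le_one.2 h1
        _ = |C| := mul_one _
    · refine le_trans ?_ (le_max_right _ _)
      have := hmain t h1
      have h3 : 0 ≤ a * t ^ (1 - k / 2) := by positivity
      linarith
  · intro t ht
    have ht0 : 0 < t := by linarith
    have e : -a * (1 - k / 2) * (1 - k / 2 - 1) = - D := by
      rw [show -a * (1 - k / 2) * (1 - k / 2 - 1) = -(a * (k / 2 * (k / 2 - 1))) by ring, ha,
        div_mul_cancel₀ _ (by positivity)]
    rw [e]
    simp only [zero_mul, add_zero]
    have h1 : h (u t) ≤ (B ^ (2 * k - 3) + K) * t ^ ((k - 2) / 2) := by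
      have h2 : u t ^ (2 * k - 3) ≤ B ^ (2 * k - 3) * t ^ ((k - 2) / 2) := by
        refine (Real.rpow_le_rpow (hu0 t ht0) (hB t ht) hk3.le).trans_eq ?_
        rw [Real.mul_rpow hB0 (by positivity), ← Real.rpow_mul ht0.le, hβk]
      have h3 : 1 ≤ t ^ ((k - 2) / 2) := Real.one_le_rpow ht (by linarith)
      have h4 := hK' (u t) (hu0 t ht0)
      have h5 : K' ≤ K := le_max_left _ _
      nlinarith
    have h2 : lam * t ^ (-k) * h (u t) ≤ D * t ^ (1 - k / 2 - 2) := by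
      calc lam * t ^ (-k) * h (u t)
          ≤ lam * t ^ (-k) * ((B ^ (2 * k - 3) + K) * t ^ ((k - 2) / 2)) := by gcongr
        _ = D * (t ^ (-k) * t ^ ((k - 2) / 2)) := by rw [hD]; ring
        _ = _ := by rw [← Real.rpow_add ht0]; congr 2; ring
    linarith

end Solution

/-- The primitive of the nonlinearity vanishing at `0`. -/
def primitive (h : ℝ → ℝ) (s : ℝ) : ℝ := ∫ σ in (0 : ℝ)..s, h σ

lemma primitive_zero (h : ℝ → ℝ) : primitive h 0 = 0 := by simp [primitive]

lemma hasDerivAt_primitive {h : ℝ → ℝ} (hc : Continuous h) (s : ℝ) :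
    HasDerivAt (primitive h) (h s) s :=
  intervalIntegral.integral_hasDerivAt_right (hc.intervalIntegrable _ _)
    (hc.stronglyMeasurableAtFilter _ _) hc.continuousAt

lemma continuous_primitive {h : ℝ → ℝ} (hc : Continuous h) : Continuous (primitive h) :=
  continuous_iff_continuousAt.2 fun s => (hasDerivAt_primitive hc s).continuousAt

lemma primitive_le_of_near {h : ℝ → ℝ} (hc : Continuous h) {s₀ c : ℝ}
    (hs : ∀ s, 0 ≤ s → s ≤ s₀ → h s ≤ -(c * s)) {s : ℝ} (h0 : 0 ≤ s) (h1 : s ≤ s₀) :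
    primitive h s ≤ -(c * s ^ 2 / 2) := by
  have : AntitoneOn (fun s => primitive h s + c * s ^ 2 / 2) (Icc 0 s₀) := by
    have hd : ∀ x, HasDerivAt (fun s => primitive h s + c * s ^ 2 / 2) (h x + c * x) x := by
      intro x
      refine ((hasDerivAt_primitive hc x).fun_add
        (((hasDerivAt_pow 2 x).const_mul c).div_const 2)).congr_deriv ?_
      simp; ring
    refine antitoneOn_of_hasDerivAt (convex_Icc _ _)
      (fun x _ => (hd x).continuousAt.continuousWithinAt) (fun x _ => hd x) fun x hx => ?_
    rw [interior_Icc] at hx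
    have := hs x hx.1.le hx.2.le
    linarith
  have := this ⟨le_rfl, h0.trans h1⟩ ⟨h0, h1⟩ h0
  simp only [primitive_zero] at this
  simp at this
  linarith

namespace Solution
variable {k lam : ℝ} {h u u' : ℝ → ℝ}

/-- The energy of the radial solution, as a function of `t`. -/
def energy (k lam : ℝ) (h u u' : ℝ → ℝ) (t : ℝ) : ℝ :=
  t ^ k * u' t ^ 2 / 2 + lam * primitive h (u t)

lemma hasDerivAt_energy (hs : Solution k lam h u u') (hh : Nonlinearity k h) {t : ℝ} (ht : 0 < t) :
    HasDerivAt (energy k lam h u u') (k * t ^ (k - 1) * u' t ^ 2 / 2) t := by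
  have h1 := ((Real.hasDerivAt_rpow_const (x := t) (p := k) (Or.inl ht.ne')).fun_mul
    ((hs.deriv' t ht).fun_pow 2)).div_const 2
  have h2 := ((hasDerivAt_primitive hh.cont (u t)).comp t (hs.deriv t ht)).const_mul lam
  refine (h1.fun_add h2).congr_deriv ?_
  have : t ^ k * t ^ (-k) = 1 := by rw [← Real.rpow_add ht]; simp
  simp only [Nat.cast_ofNat, Nat.add_one_sub_one, pow_one]
  linear_combination (-u' t * lam * h (u t)) * this

lemma monotoneOn_energy (hs : Solution k lam h u u') (hh : Nonlinearity k h) (hk : 2 < k) :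
    MonotoneOn (energy k lam h u u') (Ioi 0) := by
  refine monotoneOn_of_hasDerivAt (convex_Ioi 0)
    (fun t ht => (hs.hasDerivAt_energy hh ht).continuousAt.continuousWithinAt)
    (fun t ht => hs.hasDerivAt_energy hh (by rwa [interior_Ioi] at ht)) (fun t ht => ?_)
  rw [interior_Ioi] at ht
  have ht : 0 < t := ht
  positivity

lemma primitive_le_energy (hs : Solution k lam h u u') (hh : Nonlinearity k h) (hk : 2 < k)
    {s t : ℝ} (hs0 : 0 ≤ s) (hst : s ≤ t) (ht : 0 < t) :
    lam * primitive h (u s) ≤ energy k lam h u u' t := by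
  have hpos : ∀ r > 0, r ≤ t → lam * primitive h (u r) ≤ energy k lam h u u' t := fun r hr hrt => by
    refine le_trans ?_ (hs.monotoneOn_energy hh hk hr ht hrt)
    have : 0 ≤ r ^ k * u' r ^ 2 / 2 := by positivity
    simp only [energy]; linarith
  rcases eq_or_lt_of_le hs0 with rfl | hs0
  · have hc : ContinuousWithinAt (fun r => lam * primitive h (u r)) (Ici 0) 0 := by
      refine continuousWithinAt_const.mul ?_
      exact (continuous_primitive hh.cont).continuousAt.comp_continuousWithinAt
        (hs.continuousOn 0 self_mem_Ici)
    have hc := (hc.mono Ioi_subset_Ici_self).tendsto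
    refine le_of_tendsto hc ?_
    filter_upwards [Ioc_mem_nhdsGT ht] with r hr
    exact hpos r hr.1 hr.2
  · exact hpos s hs0 hst

lemma exists_deriv_bound (hs : Solution k lam h u u') (hh : Nonlinearity k h) (hk : 2 < k)
    (hlam : 0 < lam) : ∃ D ≥ 0, ∀ t > 0, |u' t| ≤ D * t ^ (1 - k) := by
  obtain ⟨B, hB0, hB⟩ := hs.bounded hh hk hlam
  obtain ⟨M', hM'⟩ := (isCompact_Icc (a := 0) (b := B)).exists_bound_of_continuousOn
    hh.cont.continuousOn
  set M := max M' 0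
  have hM0 : 0 ≤ M := le_max_right _ _
  have hM : ∀ t > 0, |h (u t)| ≤ M := fun t ht =>
    (hM' _ ⟨hs.nonneg hh t (le_of_lt ht), hB t (le_of_lt ht)⟩).trans (le_max_left _ _)
  have hk1 : 0 < k - 1 := by linarith
  set D := lam * M / (k - 1) with hD
  have hlim := hs.tendsto_deriv_atTop hh hk hlam
  have hder : ∀ t > 0, HasDerivAt (fun t => D * t ^ (1 - k)) (-(lam * M * t ^ (-k))) t := by
    intro t ht
    refine (hasDerivAt_const_mul_rpow D (1 - k) ht).congr_deriv ?_
    rw [hD, show 1 - k - 1 = -k by ring]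
    field_simp
    ring
  have hl := tendsto_const_mul_rpow_atTop D (p := 1 - k) (by linarith)
  refine ⟨D, by positivity, fun t ht => abs_le.2 ⟨?_, ?_⟩⟩
  · have hanti : AntitoneOn (fun t => u' t + D * t ^ (1 - k)) (Ioi 0) := by
      refine antitoneOn_of_hasDerivAt (convex_Ioi 0)
        (fun t ht => ((hs.deriv' t ht).fun_add (hder t ht)).continuousAt.continuousWithinAt)
        (fun t ht => ?_) (f' := fun t => -(lam * t ^ (-k) * h (u t)) + -(lam * M * t ^ (-k)))
        (fun t ht => ?_) <;> rw [interior_Ioi] at ht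
      · exact (hs.deriv' t ht).fun_add (hder t ht)
      · have ht : 0 < t := ht
        have h1 := neg_le_of_abs_le (hM t ht)
        have h2 : 0 ≤ lam * t ^ (-k) := by positivity
        nlinarith
    have hl' : Tendsto (fun t => u' t + D * t ^ (1 - k)) atTop (𝓝 0) := by simpa using hlim.add hl
    have : 0 ≤ u' t + D * t ^ (1 - k) := by
      refine le_of_tendsto hl' ?_
      filter_upwards [eventually_ge_atTop t] with s hs
      exact hanti ht (lt_of_lt_of_le ht hs) hs
    linarith
  · have hmono : MonotoneOn (fun t => u' t - D * t ^ (1 - k)) (Ioi 0) := by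
      refine monotoneOn_of_hasDerivAt (convex_Ioi 0)
        (fun t ht => ((hs.deriv' t ht).fun_sub (hder t ht)).continuousAt.continuousWithinAt)
        (fun t ht => ?_) (f' := fun t => -(lam * t ^ (-k) * h (u t)) - -(lam * M * t ^ (-k)))
        (fun t ht => ?_) <;> rw [interior_Ioi] at ht
      · exact (hs.deriv' t ht).fun_sub (hder t ht)
      · have ht : 0 < t := ht
        have h1 := le_of_abs_le (hM t ht)
        have h2 : 0 ≤ lam * t ^ (-k) := by positivity
        nlinarith
    have hl' : Tendsto (fun t => u' t - D * t ^ (1 - k)) atTop (𝓝 0) := by simpa using hlim.sub hl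
    have : u' t - D * t ^ (1 - k) ≤ 0 := by
      refine ge_of_tendsto hl' ?_
      filter_upwards [eventually_ge_atTop t] with s hs
      exact hmono ht (lt_of_lt_of_le ht hs) hs
    linarith

lemma deriv_nonneg (hs : Solution k lam h u u') (hh : Nonlinearity k h) (hk : 2 < k)
    (hlam : 0 < lam) : ∀ t > 0, 0 ≤ u' t := by
  by_contra! hcon
  obtain ⟨t0, ht0, hneg⟩ := hcon
  have ht0 : 0 < t0 := ht0
  have hcont' : ContinuousOn u' (Ioi 0) := fun t ht =>
    (hs.deriv' t ht).continuousAt.continuousWithinAt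
  obtain ⟨t1, ht01, ht1⟩ : ∃ t1 > t0, ∀ s ∈ Icc t0 t1, u' s < 0 := by
    have := (hs.deriv' t0 ht0).continuousAt.eventually_lt_const hneg
    obtain ⟨ε, hε, hball⟩ := Metric.eventually_nhds_iff.1 this
    refine ⟨t0 + ε / 2, by linarith, fun s hs => hball ?_⟩
    rw [Real.dist_eq, abs_of_nonneg (by linarith [hs.1])]
    linarith [hs.2]
  set E := energy k lam h u u' with hE
  have hE01 : E t0 < E t1 := by
    have : StrictMonoOn E (Icc t0 t1) := by
      refine strictMonoOn_of_hasDerivWithinAt_pos (convex_Icc _ _)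
        (fun x hx => (hs.hasDerivAt_energy hh (ht0.trans_le hx.1)).continuousAt.continuousWithinAt)
        (fun x hx => (hs.hasDerivAt_energy hh ?_).hasDerivWithinAt) fun x hx => ?_ <;>
        rw [interior_Icc] at hx
      · exact ht0.trans hx.1
      · have h1 := (ht1 x ⟨hx.1.le, hx.2.le⟩).ne
        have h2 : 0 < x := ht0.trans hx.1
        positivity
    exact this ⟨le_rfl, ht01.le⟩ ⟨ht01.le, le_rfl⟩ ht01
  have key : ∀ t ≥ t1, (∀ s ∈ Icc t0 t, u' s ≤ 0) → E t1 - E t0 ≤ t ^ k * u' t ^ 2 / 2 := by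
    intro t ht hle
    have ht0t : t0 ≤ t := ht01.le.trans ht
    have hanti : AntitoneOn u (Icc t0 t) := by
      refine antitoneOn_of_hasDerivAt (convex_Icc _ _)
        (fun x hx => (hs.deriv x (ht0.trans_le hx.1)).continuousAt.continuousWithinAt)
        (fun x hx => hs.deriv x ?_) (fun x hx => hle x (interior_subset hx))
      rw [interior_Icc] at hx
      exact ht0.trans hx.1
    have hut : u t ≤ u t0 := hanti ⟨le_rfl, ht0t⟩ ⟨ht0t, le_rfl⟩ ht0t
    obtain ⟨t2, ht2, hut2⟩ := intermediate_value_Icc ht0.le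
      (hs.continuousOn.mono Icc_subset_Ici_self)
      (show u t ∈ Icc (u 0) (u t0) from ⟨by rw [hs.zero]; exact hs.nonneg hh t (by linarith), hut⟩)
    have h1 := hs.primitive_le_energy hh hk ht2.1 ht2.2 ht0
    rw [hut2] at h1
    have h2 := hs.monotoneOn_energy hh hk (mem_Ioi.2 (ht0.trans ht01))
      (mem_Ioi.2 (ht0.trans_le ht0t)) ht
    have h3 : energy k lam h u u' t = t ^ k * u' t ^ 2 / 2 + lam * primitive h (u t) := rfl
    linarith
  have hall : ∀ t ≥ t0, u' t < 0 := by
    by_contra! hcon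
    obtain ⟨t, ht, hge⟩ := hcon
    have hIcc : Icc t0 t ⊆ Ioi 0 := fun x hx => ht0.trans_le hx.1
    have hS : IsCompact (Icc t0 t ∩ u' ⁻¹' {0}) := by
      refine IsCompact.of_isClosed_subset isCompact_Icc ?_ inter_subset_left
      exact (hcont'.mono hIcc).preimage_isClosed_of_isClosed isClosed_Icc isClosed_singleton
    obtain ⟨z, hz, hz0⟩ := intermediate_value_Icc ht (hcont'.mono hIcc)
      (show (0 : ℝ) ∈ Icc (u' t0) (u' t) from ⟨hneg.le, hge⟩)
    obtain ⟨b, ⟨⟨hb1, hb2⟩, hfb⟩, hmin⟩ := hS.exists_isLeast ⟨z, hz, hz0⟩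
    have hfb : u' b = 0 := hfb
    have hlt : ∀ s ∈ Icc t0 b, u' s ≤ 0 := fun s hsb => by
      by_contra! hpos
      obtain ⟨z, hz, hz0⟩ := intermediate_value_Icc hsb.1
        (hcont'.mono ((Icc_subset_Icc_right (hsb.2.trans hb2)).trans hIcc))
        (show (0 : ℝ) ∈ Icc (u' t0) (u' s) from ⟨hneg.le, hpos.le⟩)
      have h1 : b ≤ z := hmin ⟨⟨hz.1, hz.2.trans (hsb.2.trans hb2)⟩, hz0⟩
      have h2 : s = b := le_antisymm hsb.2 (h1.trans hz.2)
      rw [h2] at hpos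
      linarith
    have hb : t1 ≤ b := by
      by_contra! hlt
      exact (ht1 b ⟨hb1, hlt.le⟩).ne hfb
    have := key b hb hlt
    rw [hfb] at this
    simp at this
    linarith
  obtain ⟨D, hD0, hD⟩ := hs.exists_deriv_bound hh hk hlam
  have hlim := tendsto_const_mul_rpow_atTop (D ^ 2 / 2) (p := 2 - k) (by linarith)
  have hev := hlim.eventually_lt_const (sub_pos.2 hE01)
  obtain ⟨t, hlt, ht⟩ := (hev.and (eventually_ge_atTop t1)).exists
  have htpos : 0 < t := (ht0.trans ht01).trans_le ht
  have h1 := key t ht fun s hs => (hall s hs.1).le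
  have h2 : u' t ^ 2 ≤ (D * t ^ (1 - k)) ^ 2 := by
    rw [← sq_abs]
    gcongr
    exact hD t htpos
  have h3 : t ^ k * u' t ^ 2 / 2 ≤ D ^ 2 / 2 * t ^ (2 - k) := by
    calc t ^ k * u' t ^ 2 / 2 ≤ t ^ k * (D * t ^ (1 - k)) ^ 2 / 2 := by gcongr
      _ = D ^ 2 / 2 * (t ^ k * (t ^ (1 - k) * t ^ (1 - k))) := by ring
      _ = _ := by rw [← Real.rpow_add htpos, ← Real.rpow_add htpos]; congr 2; ring
  linarith

lemma monotoneOn (hs : Solution k lam h u u') (hh : Nonlinearity k h) (hk : 2 < k)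
    (hlam : 0 < lam) : MonotoneOn u (Ici 0) := by
  refine monotoneOn_of_hasDerivAt (convex_Ici 0) hs.continuousOn (fun t ht => ?_)
    (fun t ht => ?_) (f' := u') <;> rw [interior_Ici] at ht
  · exact hs.deriv t ht
  · exact hs.deriv_nonneg hh hk hlam t ht

lemma pos (hs : Solution k lam h u u') (hh : Nonlinearity k h) (hk : 2 < k)
    (hlam : 0 < lam) : ∀ t > 0, 0 < u t := by
  by_contra! hcon
  obtain ⟨t0, ht0, hle⟩ := hcon
  have hmono := hs.monotoneOn hh hk hlam
  have hnn := hs.nonneg hh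
  obtain ⟨ts, hts, hne⟩ := hs.nontrivial
  have hpos : 0 < u ts := lt_of_le_of_ne (hnn ts (le_of_lt hts)) hne.symm
  have hS : IsCompact (Icc 0 ts ∩ u ⁻¹' {0}) := by
    refine IsCompact.of_isClosed_subset isCompact_Icc ?_ inter_subset_left
    exact (hs.continuousOn.mono Icc_subset_Ici_self).preimage_isClosed_of_isClosed
      isClosed_Icc isClosed_singleton
  have ht0ts : t0 < ts := by
    by_contra! h1
    have := hmono (mem_Ici.2 (le_of_lt hts)) (mem_Ici.2 (le_of_lt ht0)) h1
    linarith
  obtain ⟨T, ⟨⟨hT1, hT2⟩, huT⟩, hmax⟩ := hS.exists_isGreatest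
    ⟨t0, ⟨le_of_lt ht0, ht0ts.le⟩, le_antisymm hle (hnn t0 (le_of_lt ht0))⟩
  have huT : u T = 0 := huT
  have hT0 : 0 < T := lt_of_lt_of_le ht0
    (hmax ⟨⟨le_of_lt ht0, ht0ts.le⟩, le_antisymm hle (hnn t0 (le_of_lt ht0))⟩)
  have hTts : T < ts := lt_of_le_of_ne hT2 (by rintro rfl; linarith)
  have hu'T : u' T = 0 := by
    refine IsLocalMin.hasDerivAt_eq_zero ?_ (hs.deriv T hT0)
    filter_upwards [Ioi_mem_nhds hT0] with s hs'
    rw [huT]; exact hnn s (le_of_lt hs')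
  obtain ⟨s₀, hs₀, c, hc, K', hnear⟩ := hh.near
  set K := max K' 0
  have hK0 : 0 ≤ K := le_max_right _ _
  set L := lam * T ^ (-k) * K with hL
  have hL0 : 0 ≤ L := by positivity
  have hcontT := (hs.deriv T hT0).continuousAt
  obtain ⟨ε, hε, hball⟩ := Metric.eventually_nhds_iff.1
    (hcontT.eventually_lt_const (show u T < s₀ by rw [huT]; exact hs₀))
  set δ := min (min (ε / 2) (ts - T)) (1 / (L + 2)) with hδ
  have hδ0 : 0 < δ := by
    refine lt_min (lt_min (by linarith) (by linarith)) (by positivity)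
  have hδ1 : δ ≤ ε / 2 := (min_le_left _ _).trans (min_le_left _ _)
  have hδ2 : δ ≤ ts - T := (min_le_left _ _).trans (min_le_right _ _)
  have hδ3 : δ ≤ 1 / (L + 2) := min_le_right _ _
  have hδ4 : (L + 2) * δ ≤ 1 := by
    rw [le_div_iff₀ (by positivity)] at hδ3; linarith
  have hδ5 : L * δ * δ < 1 := by nlinarith
  set U := u (T + δ) with hU
  have hU0 : 0 < U := by
    refine lt_of_le_of_ne (hnn _ (by linarith)) fun h0 => ?_
    have := hmax ⟨⟨by linarith, by linarith⟩, h0.symm⟩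
    linarith
  obtain ⟨c1, hc1, hc1'⟩ := exists_hasDerivAt_eq_slope u u' (show T < T + δ by linarith)
    (hs.continuousOn.mono fun x hx => hT0.le.trans hx.1) (fun x hx => hs.deriv x (hT0.trans hx.1))
  obtain ⟨c2, hc2, hc2'⟩ := exists_hasDerivAt_eq_slope u' (fun t => -(lam * t ^ (-k) * h (u t)))
    hc1.1 (fun x hx => (hs.deriv' x (hT0.trans_le hx.1)).continuousAt.continuousWithinAt)
    (fun x hx => hs.deriv' x (hT0.trans hx.1))
  have hc20 : 0 < c2 := hT0.trans hc2.1
  have hu2 : 0 ≤ u c2 := hnn _ hc20.le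
  have hu2U : u c2 ≤ U := hmono (mem_Ici.2 hc20.le) (mem_Ici.2 (by linarith))
    (hc2.2.trans hc1.2).le
  have hu2s : u c2 ≤ s₀ := by
    refine (hball ?_).le
    rw [Real.dist_eq, abs_of_nonneg (by linarith [hc2.1])]
    linarith [hc2.2, hc1.2]
  have h1 : -(lam * c2 ^ (-k) * h (u c2)) ≤ L * U := by
    have h2 := (hnear _ hu2 hu2s).1
    have h3 : -h (u c2) ≤ K * U := by
      have : K' * u c2 ≤ K * U := mul_le_mul (le_max_left _ _) hu2U hu2 hK0
      linarith
    have h4 : c2 ^ (-k) ≤ T ^ (-k) :=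
      Real.rpow_le_rpow_of_nonpos hT0 hc2.1.le (by linarith)
    calc -(lam * c2 ^ (-k) * h (u c2)) = lam * c2 ^ (-k) * (-h (u c2)) := by ring
      _ ≤ lam * c2 ^ (-k) * (K * U) := by gcongr
      _ ≤ lam * T ^ (-k) * (K * U) := by gcongr
      _ = L * U := by rw [hL]; ring
  have h2 : u' c1 ≤ L * U * δ := by
    have h3 : 0 < c1 - T := by linarith [hc1.1]
    rw [hc2', hu'T, sub_zero, div_le_iff₀ h3] at h1
    refine h1.trans ?_
    have : c1 - T ≤ δ := by linarith [hc1.2]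
    have : 0 ≤ L * U := by positivity
    gcongr
  rw [hc1', huT, sub_zero, add_sub_cancel_left, div_le_iff₀ hδ0] at h2
  nlinarith

/-- Exponential decay in the variable `r = t ^ (1 - k / 2)`. -/
lemma exists_exp_decay (hs : Solution k lam h u u') (hh : Nonlinearity k h) (hk : 2 < k)
    (hlam : 0 < lam) : ∃ C ≥ 0, ∃ b > 0, ∃ τ > 0, ∀ t > 0, t ≤ τ →
      u t ≤ C * Real.exp (-(b * t ^ (1 - k / 2))) ∧
      u' t * t ≤ C * Real.exp (-(b * t ^ (1 - k / 2))) := by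
  obtain ⟨s₀, hs₀, c, hc, K', hnear⟩ := hh.near
  have hmono := hs.monotoneOn hh hk hlam
  obtain ⟨τ, hτ, huτ⟩ : ∃ τ > 0, u τ ≤ s₀ := by
    have h1 := (hs.continuousOn 0 self_mem_Ici).mono Ioi_subset_Ici_self
    have h2 := h1.tendsto.eventually_lt_const (show u 0 < s₀ by rw [hs.zero]; exact hs₀)
    obtain ⟨τ, h3, h4⟩ := (h2.and self_mem_nhdsWithin).exists
    exact ⟨τ, h4, h3.le⟩
  have hus : ∀ t, 0 ≤ t → t ≤ τ → u t ≤ s₀ := fun t ht htτ =>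
    (hmono (mem_Ici.2 ht) (mem_Ici.2 (le_of_lt hτ)) htτ).trans huτ
  set a := √(lam * c) with ha
  have ha0 : 0 < a := Real.sqrt_pos.2 (by positivity)
  have hder : ∀ t > 0, t ≤ τ → a * t ^ (-(k / 2)) * u t ≤ u' t := fun t ht htτ => by
    have ht : 0 < t := ht
    have hu0 := hs.nonneg hh t ht.le
    refine abs_le_of_sq_le_sq' ?_ (hs.deriv_nonneg hh hk hlam t ht) |>.2
    have h1 := hs.primitive_le_energy hh hk le_rfl ht.le ht
    rw [hs.zero, primitive_zero, mul_zero, energy] at h1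
    have h2 := primitive_le_of_near hh.cont (fun s h1 h2 => (hnear s h1 h2).2) hu0
      (hus t ht.le htτ)
    have h3 : lam * primitive h (u t) ≤ lam * -(c * u t ^ 2 / 2) := by gcongr
    have h4 : lam * c * u t ^ 2 ≤ t ^ k * u' t ^ 2 := by linarith
    have h5 : (t ^ (-(k / 2))) ^ 2 * t ^ k = 1 := by
      rw [sq, ← Real.rpow_add ht, ← Real.rpow_add ht]
      ring_nf; simp
    calc (a * t ^ (-(k / 2)) * u t) ^ 2 = (t ^ (-(k / 2))) ^ 2 * (a ^ 2 * u t ^ 2) := by ring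
      _ = (t ^ (-(k / 2))) ^ 2 * (lam * c * u t ^ 2) := by
        rw [ha, Real.sq_sqrt (by positivity)]
      _ ≤ (t ^ (-(k / 2))) ^ 2 * (t ^ k * u' t ^ 2) := by gcongr
      _ = u' t ^ 2 := by rw [← mul_assoc, h5, one_mul]
  have hk2 : 0 < k / 2 - 1 := by linarith
  set b := a / (k / 2 - 1) with hb
  have hb0 : 0 < b := by positivity
  have hmono' : MonotoneOn (fun t => u t * Real.exp (b * t ^ (1 - k / 2))) (Ioc 0 τ) := by
    have hd : ∀ t > 0, HasDerivAt (fun t => u t * Real.exp (b * t ^ (1 - k / 2)))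
        ((u' t - a * t ^ (-(k / 2)) * u t) * Real.exp (b * t ^ (1 - k / 2))) t := fun t ht => by
      refine ((hs.deriv t ht).fun_mul
        ((hasDerivAt_const_mul_rpow b (1 - k / 2) ht).exp)).congr_deriv ?_
      have : b * (1 - k / 2) = -a := by
        rw [show b * (1 - k / 2) = -(b * (k / 2 - 1)) by ring, hb, div_mul_cancel₀ _ hk2.ne']
      rw [this, show 1 - k / 2 - 1 = -(k / 2) by ring]
      ring
    refine monotoneOn_of_hasDerivAt (convex_Ioc 0 τ)
      (fun t ht => (hd t ht.1).continuousAt.continuousWithinAt) (fun t ht => hd t ?_)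
      fun t ht => ?_
    · exact (interior_subset ht).1
    · have ht := interior_subset ht
      have := hder t ht.1 ht.2
      have : 0 ≤ u' t - a * t ^ (-(k / 2)) * u t := by linarith
      positivity
  have hτ0 : (0 : ℝ) < τ := hτ
  set C := u τ * Real.exp (b * τ ^ (1 - k / 2)) with hC
  have hC0 : 0 ≤ C := mul_nonneg (hs.nonneg hh τ hτ0.le) (Real.exp_pos _).le
  have hdecay : ∀ t > 0, t ≤ τ → u t ≤ C * Real.exp (-(b * t ^ (1 - k / 2))) := fun t ht htτ => by
    have := hmono' ⟨ht, htτ⟩ ⟨hτ0, le_rfl⟩ htτ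
    rw [Real.exp_neg, ← div_eq_mul_inv, le_div_iff₀ (Real.exp_pos _)]
    exact this
  have hmonod : MonotoneOn u' (Ioc 0 τ) := by
    refine monotoneOn_of_hasDerivAt (convex_Ioc 0 τ)
      (fun t ht => (hs.deriv' t ht.1).continuousAt.continuousWithinAt)
      (fun t ht => hs.deriv' t (interior_subset ht).1) fun t ht => ?_
    have ht := interior_subset ht
    have ht0 : 0 < t := ht.1
    have hu0 := hs.nonneg hh t ht0.le
    have h1 := (hnear (u t) hu0 (hus t ht0.le ht.2)).2
    have h2 : h (u t) ≤ 0 := h1.trans (by have := mul_nonneg hc.le hu0; linarith)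
    have h3 : 0 ≤ lam * t ^ (-k) := by positivity
    nlinarith
  refine ⟨C, hC0, b * 2 ^ (1 - k / 2), by positivity, τ / 2, by positivity, fun t ht htτ => ?_⟩
  have ht : 0 < t := ht
  have h2t := hdecay (2 * t) (by positivity) (by linarith)
  rw [Real.mul_rpow zero_le_two ht.le, ← mul_assoc] at h2t
  refine ⟨(hmono (mem_Ici.2 ht.le) (mem_Ici.2 (by linarith)) (by linarith)).trans h2t, ?_⟩
  refine le_trans ?_ h2t
  obtain ⟨c1, hc1, hc1'⟩ := exists_hasDerivAt_eq_slope u u' (show t < 2 * t by linarith)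
    (hs.continuousOn.mono fun x hx => ht.le.trans hx.1) (fun x hx => hs.deriv x (ht.trans hx.1))
  have h1 := hmonod ⟨ht, by linarith⟩ ⟨ht.trans hc1.1, by linarith [hc1.2]⟩ hc1.1.le
  rw [hc1', le_div_iff₀ (by linarith)] at h1
  have := hs.nonneg hh t ht.le
  linarith

end Solution

/-- The primitive on `[0, ∞)` vanishing at `0` of a square integrable function. -/
def prim (P : Lp ℝ 2 (volume : Measure ℝ)) (t : ℝ) : ℝ := ∫ s in Ioc 0 t, P s

lemma prim_eq_inner (P : Lp ℝ 2 (volume : Measure ℝ)) (t : ℝ) :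
    prim P t = inner ℝ (indicatorConstLp 2 (measurableSet_Ioc (a := 0) (b := t))
      measure_Ioc_lt_top.ne (1 : ℝ)) P := by
  rw [L2.inner_indicatorConstLp_one]; rfl

lemma prim_add (P Q : Lp ℝ 2 (volume : Measure ℝ)) (t : ℝ) :
    prim (P + Q) t = prim P t + prim Q t := by
  simp only [prim_eq_inner, inner_add_right]

lemma prim_smul (c : ℝ) (P : Lp ℝ 2 (volume : Measure ℝ)) (t : ℝ) :
    prim (c • P) t = c * prim P t := by
  simp only [prim_eq_inner, inner_smul_right]

lemma prim_of_nonpos (P : Lp ℝ 2 (volume : Measure ℝ)) {t : ℝ} (ht : t ≤ 0) : prim P t = 0 := by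
  simp [prim, Ioc_eq_empty_of_le ht]

lemma prim_sub_eq_inner (P : Lp ℝ 2 (volume : Measure ℝ)) {s t : ℝ} (hs : 0 ≤ s) (hst : s ≤ t) :
    prim P t - prim P s = inner ℝ (indicatorConstLp 2 (measurableSet_Ioc (a := s) (b := t))
      measure_Ioc_lt_top.ne (1 : ℝ)) P := by
  rw [L2.inner_indicatorConstLp_one, sub_eq_iff_eq_add', prim, prim, ← Ioc_union_Ioc_eq_Ioc hs hst]
  have hi : ∀ a b : ℝ, IntegrableOn P (Ioc a b) := fun a b =>
    ((Lp.memLp P).restrict _).integrable (by norm_num)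
  exact setIntegral_union (Ioc_disjoint_Ioc_of_le le_rfl) measurableSet_Ioc (hi _ _) (hi _ _)

lemma abs_prim_sub_le (P : Lp ℝ 2 (volume : Measure ℝ)) {s t : ℝ} (hs : 0 ≤ s) (hst : s ≤ t) :
    |prim P t - prim P s| ≤ √(t - s) * ‖P‖ := by
  rw [prim_sub_eq_inner P hs hst]
  refine (abs_real_inner_le_norm _ _).trans (le_of_eq ?_)
  rw [norm_indicatorConstLp (by norm_num) (by norm_num)]
  simp [Measure.real, Real.sqrt_eq_rpow, ENNReal.toReal_ofReal (sub_nonneg.2 hst)]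

lemma abs_prim_le (P : Lp ℝ 2 (volume : Measure ℝ)) {t : ℝ} (ht : 0 ≤ t) :
    |prim P t| ≤ √t * ‖P‖ := by
  simpa [prim_of_nonpos P le_rfl] using abs_prim_sub_le P le_rfl ht

lemma continuous_prim (P : Lp ℝ 2 (volume : Measure ℝ)) : Continuous (prim P) := by
  have hmax : prim P = fun t => prim P (max t 0) := by
    funext t
    rcases le_total t 0 with h | h
    · rw [max_eq_right h, prim_of_nonpos P h, prim_of_nonpos P le_rfl]
    · rw [max_eq_left h]
  have key : ∀ s t : ℝ, |prim P t - prim P s| ≤ √|max t 0 - max s 0| * ‖P‖ := by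
    intro s t
    rw [hmax]
    rcases le_total (max s 0) (max t 0) with h | h
    · simpa [abs_of_nonneg (sub_nonneg.2 h)] using abs_prim_sub_le P (le_max_right s 0) h
    · rw [abs_sub_comm, abs_sub_comm (max t 0)]
      simpa [abs_of_nonneg (sub_nonneg.2 h)] using abs_prim_sub_le P (le_max_right t 0) h
  refine continuous_iff_continuousAt.2 fun s => ?_
  rw [ContinuousAt, tendsto_iff_dist_tendsto_zero]
  have hc : Continuous fun t : ℝ => √|max t 0 - max s 0| * ‖P‖ := by fun_prop
  refine squeeze_zero (fun t => dist_nonneg) (fun t => (Real.dist_eq _ _).trans_le (key s t)) ?_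
  simpa using hc.tendsto s

/-- Cauchy–Schwarz with the weight `√s`. -/
lemma enorm_prim_sq_le (P : Lp ℝ 2 (volume : Measure ℝ)) {t : ℝ} (ht : 0 < t) :
    ‖prim P t‖ₑ ^ 2 ≤ ENNReal.ofReal (2 * t ^ (1 / 2 : ℝ)) *
      ∫⁻ s in Ioc 0 t, ENNReal.ofReal (s ^ (1 / 2 : ℝ)) * ‖P s‖ₑ ^ 2 := by
  set f : ℝ → ℝ≥0∞ := fun s => ENNReal.ofReal (s ^ (-(1 / 4) : ℝ)) with hf
  set g : ℝ → ℝ≥0∞ := fun s => ENNReal.ofReal (s ^ (1 / 4 : ℝ)) * ‖P s‖ₑ with hg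
  have hPm : AEMeasurable (fun s => ‖P s‖ₑ) (volume.restrict (Ioc 0 t)) :=
    (Lp.aestronglyMeasurable P).restrict.enorm
  have h1 : ‖prim P t‖ₑ ≤ ∫⁻ s in Ioc 0 t, (f * g) s := by
    refine (enorm_integral_le_lintegral_enorm _).trans (le_of_eq ?_)
    refine setLIntegral_congr_fun measurableSet_Ioc fun s hs => ?_
    have : ENNReal.ofReal (s ^ (-(1 / 4) : ℝ)) * ENNReal.ofReal (s ^ (1 / 4 : ℝ)) = 1 := by
      rw [← ENNReal.ofReal_mul (Real.rpow_nonneg hs.1.le _), ← Real.rpow_add hs.1]; simp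
    simp only [Pi.mul_apply, hf, hg, ← mul_assoc, this, one_mul]
  have h2 := ENNReal.lintegral_mul_le_Lp_mul_Lq (volume.restrict (Ioc 0 t))
    Real.HolderConjugate.two_two (f := f) (g := g) (by fun_prop) (by fun_prop)
  have h3 : ∫⁻ s in Ioc 0 t, f s ^ (2 : ℝ) = ENNReal.ofReal (2 * t ^ (1 / 2 : ℝ)) := by
    have hi : IntegrableOn (fun s : ℝ => s ^ (-(1 / 2) : ℝ)) (Ioc 0 t) :=
      (intervalIntegrable_iff_integrableOn_Ioc_of_le ht.le).1
        (intervalIntegral.intervalIntegrable_rpow' (by norm_num))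
    have : ∫ s in Ioc 0 t, s ^ (-(1 / 2) : ℝ) = 2 * t ^ (1 / 2 : ℝ) := by
      rw [← intervalIntegral.integral_of_le ht.le, integral_rpow (Or.inl (by norm_num))]
      norm_num; ring
    rw [← this, ofReal_integral_eq_lintegral_ofReal hi
      ((ae_restrict_mem measurableSet_Ioc).mono fun s hs => Real.rpow_nonneg hs.1.le _)]
    refine setLIntegral_congr_fun measurableSet_Ioc fun s hs => ?_
    simp only [hf]
    rw [ENNReal.ofReal_rpow_of_nonneg (Real.rpow_nonneg hs.1.le _) (by norm_num),
      ← Real.rpow_mul hs.1.le]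
    norm_num
  have h4 : ∫⁻ s in Ioc 0 t, g s ^ (2 : ℝ) =
      ∫⁻ s in Ioc 0 t, ENNReal.ofReal (s ^ (1 / 2 : ℝ)) * ‖P s‖ₑ ^ 2 := by
    refine setLIntegral_congr_fun measurableSet_Ioc fun s hs => ?_
    simp only [hg]
    rw [ENNReal.mul_rpow_of_nonneg _ _ (by norm_num),
      ENNReal.ofReal_rpow_of_nonneg (Real.rpow_nonneg hs.1.le _) (by norm_num),
      ← Real.rpow_mul hs.1.le]
    norm_num
  rw [h3, h4] at h2
  have h5 := pow_le_pow_left₀ zero_le (h1.trans h2) 2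
  refine h5.trans (le_of_eq ?_)
  rw [mul_pow]
  simp only [← ENNReal.rpow_natCast, ← ENNReal.rpow_mul]
  norm_num

lemma lintegral_Ioi_rpow {s : ℝ} (hs : 0 < s) :
    ∫⁻ t in Ioi s, ENNReal.ofReal (2 * t ^ (-(3 / 2) : ℝ)) =
      ENNReal.ofReal (4 * s ^ (-(1 / 2) : ℝ)) := by
  have hi := (integrableOn_Ioi_rpow_of_lt (a := -(3 / 2)) (by norm_num) hs).const_mul 2
  rw [← ofReal_integral_eq_lintegral_ofReal hi ((ae_restrict_mem measurableSet_Ioi).mono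
    fun t ht => by have := hs.trans ht; positivity)]
  rw [integral_const_mul, integral_Ioi_rpow_of_lt (by norm_num) hs]
  congr 1
  norm_num
  ring

/-- Hardy's inequality. -/
lemma lintegral_prim_sq_le (P : Lp ℝ 2 (volume : Measure ℝ)) :
    ∫⁻ t in Ioi 0, ‖prim P t‖ₑ ^ 2 * ENNReal.ofReal (t ^ (-2 : ℝ)) ≤
      4 * ENNReal.ofReal (‖P‖ ^ 2) := by
  set F : ℝ → ℝ≥0∞ := fun s => ENNReal.ofReal (s ^ (1 / 2 : ℝ)) * ‖P s‖ₑ ^ 2 with hF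
  set w : ℝ → ℝ≥0∞ := fun t => ENNReal.ofReal (2 * t ^ (-(3 / 2) : ℝ)) with hw
  have hwm : Measurable w := by fun_prop
  have hPm : AEMeasurable (fun s => ‖P s‖ₑ) volume := (Lp.aestronglyMeasurable P).enorm
  have hFm : AEMeasurable F volume := by fun_prop
  have h1 : ∫⁻ t in Ioi 0, ‖prim P t‖ₑ ^ 2 * ENNReal.ofReal (t ^ (-2 : ℝ)) ≤
      ∫⁻ t in Ioi 0, ∫⁻ s in Ioi 0, (Ici s).indicator w t * F s := by
    refine setLIntegral_mono' measurableSet_Ioi fun t ht => ?_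
    have ht : 0 < t := ht
    calc _ ≤ (ENNReal.ofReal (2 * t ^ (1 / 2 : ℝ)) * ∫⁻ s in Ioc 0 t, F s) *
          ENNReal.ofReal (t ^ (-2 : ℝ)) := by gcongr; exact enorm_prim_sq_le P ht
      _ = w t * ∫⁻ s in Ioc 0 t, F s := by
        rw [mul_right_comm, ← ENNReal.ofReal_mul (by positivity), mul_assoc 2,
          ← Real.rpow_add ht]
        norm_num [hw]
      _ = ∫⁻ s in Ioc 0 t, w t * F s := (lintegral_const_mul'' _ hFm.restrict).symm
      _ = ∫⁻ s in Ioi 0, (Iic t).indicator (fun s => w t * F s) s := by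
        rw [setLIntegral_indicator measurableSet_Iic, inter_comm, Ioi_inter_Iic]
      _ = _ := by
        refine lintegral_congr fun s => ?_
        by_cases h : s ≤ t <;> simp [indicator, h]
  have hm : AEMeasurable (Function.uncurry fun t s : ℝ => (Ici s).indicator w t * F s)
      ((volume.restrict (Ioi 0)).prod (volume.restrict (Ioi 0))) := by
    have h2 : AEMeasurable (fun p : ℝ × ℝ => F p.2)
        ((volume.restrict (Ioi 0)).prod (volume.restrict (Ioi 0))) := hFm.restrict.comp_snd
    have h3 : Measurable ({p : ℝ × ℝ | p.2 ≤ p.1}.indicator fun p => w p.1) :=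
      (hwm.comp measurable_fst).indicator (measurableSet_le measurable_snd measurable_fst)
    exact h3.aemeasurable.mul h2
  rw [lintegral_lintegral_swap hm] at h1
  refine h1.trans ?_
  calc _ = ∫⁻ s in Ioi 0, 4 * ‖P s‖ₑ ^ 2 := by
        refine setLIntegral_congr_fun measurableSet_Ioi fun s hs => ?_
        have hs : 0 < s := hs
        have : Ici s ∩ Ioi 0 = Ici s := inter_eq_left.2 fun t ht => hs.trans_le ht
        rw [lintegral_mul_const _ (hwm.indicator measurableSet_Ici),
          setLIntegral_indicator measurableSet_Ici, this, ← restrict_Ioi_eq_restrict_Ici,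
          lintegral_Ioi_rpow hs, ← mul_assoc, ← ENNReal.ofReal_mul (by positivity), mul_assoc 4,
          ← Real.rpow_add hs]
        norm_num
    _ ≤ ∫⁻ s, 4 * ‖P s‖ₑ ^ 2 := setLIntegral_le_lintegral _ _
    _ = 4 * ENNReal.ofReal (‖P‖ ^ 2) := by
        rw [lintegral_const_mul'' _ (hPm.pow_const 2), ENNReal.ofReal_pow (norm_nonneg _),
          ofReal_norm, Lp.enorm_def, eLpNorm_eq_lintegral_rpow_enorm_toReal (by norm_num) (by norm_num),
          ← ENNReal.rpow_natCast, ← ENNReal.rpow_mul]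
        norm_num

lemma integrableOn_prim_sq (P : Lp ℝ 2 (volume : Measure ℝ)) :
    IntegrableOn (fun t => prim P t ^ 2 * t ^ (-2 : ℝ)) (Ioi 0) ∧
      ∫ t in Ioi 0, prim P t ^ 2 * t ^ (-2 : ℝ) ≤ 4 * ‖P‖ ^ 2 := by
  have h0 : 0 ≤ᵐ[volume.restrict (Ioi 0)] fun t : ℝ => prim P t ^ 2 * t ^ (-2 : ℝ) :=
    (ae_restrict_mem measurableSet_Ioi).mono fun t ht => by
      have : 0 < t := ht
      simp only [Pi.zero_apply]; positivity
  have hm : AEStronglyMeasurable (fun t : ℝ => prim P t ^ 2 * t ^ (-2 : ℝ))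
      (volume.restrict (Ioi 0)) := by
    have := (continuous_prim P).measurable
    exact (by fun_prop : Measurable fun t : ℝ => prim P t ^ 2 * t ^ (-2 : ℝ)).aestronglyMeasurable
  have hle : ∫⁻ t in Ioi 0, ENNReal.ofReal (prim P t ^ 2 * t ^ (-2 : ℝ)) ≤
      ENNReal.ofReal (4 * ‖P‖ ^ 2) := by
    refine le_trans (le_of_eq ?_) ((lintegral_prim_sq_le P).trans (le_of_eq ?_))
    · refine lintegral_congr fun t => ?_
      rw [ENNReal.ofReal_mul (sq_nonneg _), ← sq_abs, ENNReal.ofReal_pow (abs_nonneg _),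
        ← Real.norm_eq_abs, ofReal_norm]
    · rw [ENNReal.ofReal_mul (by norm_num)]; norm_num
  refine ⟨⟨hm, ?_⟩, ?_⟩
  · rw [hasFiniteIntegral_iff_ofReal h0]; exact hle.trans_lt ENNReal.ofReal_lt_top
  · rw [integral_eq_lintegral_of_nonneg_ae h0 hm]
    exact ENNReal.toReal_le_of_le_ofReal (by positivity) hle

section

variable {k : ℝ} {h : ℝ → ℝ}

lemma primitive_of_nonpos (hh : Nonlinearity k h) {s : ℝ} (hs : s ≤ 0) : primitive h s = 0 := by
  rw [primitive, intervalIntegral.integral_symm, intervalIntegral.integral_of_le hs,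
    setIntegral_congr_fun measurableSet_Ioc (g := fun _ => (0 : ℝ)) fun σ hσ => hh.zero σ hσ.2]
  simp

lemma exists_primitive_nonpos (hh : Nonlinearity k h) :
    ∃ s₀ > 0, h s₀ < 0 ∧ ∀ s ≤ s₀, primitive h s ≤ 0 := by
  obtain ⟨s₀, hs₀, c, hc, K, hn⟩ := hh.near
  refine ⟨s₀, hs₀, (hn s₀ hs₀.le le_rfl).2.trans_lt (by simp; positivity), fun s hs => ?_⟩
  rcases le_total s 0 with h0 | h0
  · exact (primitive_of_nonpos hh h0).le
  · refine (primitive_le_of_near hh.cont (fun s h0 h1 => (hn s h0 h1).2) h0 hs).trans ?_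
    have : 0 ≤ c * s ^ 2 / 2 := by positivity
    linarith

lemma exists_le_primitive (hh : Nonlinearity k h) : ∃ M ≥ 0, ∀ s, -M ≤ primitive h s := by
  obtain ⟨s₁, hs₁⟩ := hh.large
  obtain ⟨M, hM⟩ := (isCompact_Icc (a := 0) (b := max s₁ 0)).exists_bound_of_continuousOn
    (continuous_primitive hh.cont).continuousOn
  have hM0 : 0 ≤ M := (norm_nonneg _).trans (hM 0 ⟨le_rfl, le_max_right _ _⟩)
  refine ⟨M, hM0, fun s => ?_⟩
  rcases le_total s 0 with h0 | h0
  · rw [primitive_of_nonpos hh h0]; linarith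
  rcases le_total s (max s₁ 0) with h1 | h1
  · exact (abs_le.1 (hM s ⟨h0, h1⟩)).1
  · have : MonotoneOn (primitive h) (Ici (max s₁ 0)) :=
      monotoneOn_of_hasDerivAt (convex_Ici _) (continuous_primitive hh.cont).continuousOn
        (fun x _ => hasDerivAt_primitive hh.cont x) fun x hx => by
          rw [interior_Ici] at hx
          exact hs₁ x ((le_max_left _ _).trans (le_of_lt hx))
    exact (abs_le.1 (hM (max s₁ 0) ⟨le_max_right _ _, le_rfl⟩)).1.trans
      (this self_mem_Ici h1 h1)

lemma exists_primitive_le (hh : Nonlinearity k h) (hk : 2 < k) {ε : ℝ} (hε : 0 < ε) :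
    ∃ C ≥ 0, ∀ s, primitive h s ≤ ε * |s| ^ (2 * k - 2) + C := by
  obtain ⟨C, hC⟩ := hh.growth ε hε
  have hpow : Tendsto (fun s : ℝ => ε * (2 * k - 3) * s ^ (2 * k - 3)) atTop atTop :=
    (tendsto_rpow_atTop (by linarith)).const_mul_atTop (mul_pos hε (by linarith))
  obtain ⟨s₁, hs₁⟩ := eventually_atTop.1 (hpow.eventually_ge_atTop C)
  set F : ℝ → ℝ := fun s => primitive h s - ε * s ^ (2 * k - 2) with hF
  have hFc : ContinuousOn F (Ici 0) := (continuous_primitive hh.cont).continuousOn.sub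
    (((Real.continuous_rpow_const (by linarith)).const_mul ε).continuousOn)
  obtain ⟨M, hM⟩ := (isCompact_Icc (a := 0) (b := max s₁ 1)).exists_bound_of_continuousOn
    (hFc.mono Icc_subset_Ici_self)
  have h01 : (0 : ℝ) ≤ max s₁ 1 := zero_le_one.trans (le_max_right _ _)
  have hM0 : 0 ≤ M := (norm_nonneg _).trans (hM 0 ⟨le_rfl, h01⟩)
  refine ⟨M, hM0, fun s => ?_⟩
  rcases le_total s 0 with h0 | h0
  · rw [primitive_of_nonpos hh h0]; positivity
  rw [abs_of_nonneg h0]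
  suffices F s ≤ M by simp only [hF] at this; linarith
  rcases le_total s (max s₁ 1) with h1 | h1
  · exact (abs_le.1 (hM s ⟨h0, h1⟩)).2
  · have : AntitoneOn F (Ici (max s₁ 1)) := by
      refine antitoneOn_of_hasDerivAt (convex_Ici _) (hFc.mono (Ici_subset_Ici.2 h01))
        (f' := fun s => h s - ε * ((2 * k - 2) * s ^ (2 * k - 2 - 1)))
        (fun x hx => ?_) fun x hx => ?_ <;> rw [interior_Ici] at hx
      · have hx0 : x ≠ 0 := (zero_lt_one.trans_le ((le_max_right s₁ 1).trans (le_of_lt hx))).ne'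
        exact (hasDerivAt_primitive hh.cont x).fun_sub
          ((Real.hasDerivAt_rpow_const (Or.inl hx0)).const_mul ε)
      · have hx0 : 0 ≤ x := h01.trans (le_of_lt hx)
        have e1 := hs₁ x ((le_max_left _ _).trans (le_of_lt hx))
        have e2 := hC x hx0
        have e3 : 2 * k - 2 - 1 = 2 * k - 3 := by ring
        simp only [e3]
        nlinarith
    exact (this self_mem_Ici h1 h1).trans (abs_le.1 (hM _ ⟨h01, le_rfl⟩)).2

lemma integrableOn_prim_rpow (hk : 2 < k) (P : Lp ℝ 2 (volume : Measure ℝ)) :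
    IntegrableOn (fun t => |prim P t| ^ (2 * k - 2) * t ^ (-k)) (Ioi 0) ∧
      ∫ t in Ioi 0, |prim P t| ^ (2 * k - 2) * t ^ (-k) ≤
        ‖P‖ ^ (2 * k - 4) * (4 * ‖P‖ ^ 2) := by
  obtain ⟨hi, hle⟩ := integrableOn_prim_sq P
  have hb : ∀ t ∈ Ioi (0 : ℝ), |prim P t| ^ (2 * k - 2) * t ^ (-k) ≤
      ‖P‖ ^ (2 * k - 4) * (prim P t ^ 2 * t ^ (-2 : ℝ)) := fun t ht => by
    have ht : 0 < t := ht
    have e1 : |prim P t| ^ (2 * k - 2) = |prim P t| ^ (2 * k - 4) * prim P t ^ 2 := by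
      rw [← sq_abs, ← Real.rpow_natCast, ← Real.rpow_add_of_nonneg (abs_nonneg _) (by linarith)
        (by norm_num)]
      congr 1; push_cast; ring
    have e2 : |prim P t| ^ (2 * k - 4) ≤ t ^ (k - 2) * ‖P‖ ^ (2 * k - 4) := by
      refine (Real.rpow_le_rpow (abs_nonneg _) (abs_prim_le P ht.le) (by linarith)).trans
        (le_of_eq ?_)
      rw [Real.mul_rpow (by positivity) (by positivity), Real.sqrt_eq_rpow, ← Real.rpow_mul ht.le]
      congr 2; ring
    have e3 : t ^ (k - 2) * t ^ (-k) = t ^ (-2 : ℝ) := by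
      rw [← Real.rpow_add ht]; congr 1; ring
    calc _ ≤ t ^ (k - 2) * ‖P‖ ^ (2 * k - 4) * prim P t ^ 2 * t ^ (-k) := by
          rw [e1]; gcongr
      _ = _ := by rw [← e3]; ring
  have hm : AEStronglyMeasurable (fun t : ℝ => |prim P t| ^ (2 * k - 2) * t ^ (-k))
      (volume.restrict (Ioi 0)) := by
    have := (continuous_prim P).measurable
    exact (by fun_prop : Measurable fun t : ℝ =>
      |prim P t| ^ (2 * k - 2) * t ^ (-k)).aestronglyMeasurable
  have hi' : IntegrableOn (fun t => |prim P t| ^ (2 * k - 2) * t ^ (-k)) (Ioi 0) := by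
    refine (hi.const_mul (‖P‖ ^ (2 * k - 4))).mono' hm ((ae_restrict_mem measurableSet_Ioi).mono fun t ht => ?_)
    have h0 : 0 < t := ht
    rw [Real.norm_of_nonneg (by positivity)]
    exact hb t ht
  refine ⟨hi', (setIntegral_mono_on hi' (hi.const_mul _) measurableSet_Ioi hb).trans ?_⟩
  rw [integral_const_mul]
  gcongr

/-- A form of Fatou's lemma for real valued functions. -/
lemma integral_le_of_tendsto {α : Type*} [MeasurableSpace α] {μ : Measure α} {f : ℕ → α → ℝ}
    {F : α → ℝ} {c : ℝ} (hf : ∀ n, Integrable (f n) μ) (h0 : ∀ n, 0 ≤ᵐ[μ] f n)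
    (hlim : ∀ᵐ x ∂μ, Tendsto (fun n => f n x) atTop (𝓝 (F x)))
    (hb : ∀ n, ∫ x, f n x ∂μ ≤ c) : Integrable F μ ∧ ∫ x, F x ∂μ ≤ c := by
  have hc : 0 ≤ c := (integral_nonneg_of_ae (h0 0)).trans (hb 0)
  have hm : AEStronglyMeasurable F μ := aestronglyMeasurable_of_tendsto_ae atTop
    (fun n => (hf n).aestronglyMeasurable) hlim
  have hF0 : 0 ≤ᵐ[μ] F := by
    filter_upwards [hlim, ae_all_iff.2 h0] with x hx hx0
    exact ge_of_tendsto' hx hx0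
  have hle : ∫⁻ x, ENNReal.ofReal (F x) ∂μ ≤ ENNReal.ofReal c := by
    calc ∫⁻ x, ENNReal.ofReal (F x) ∂μ
        = ∫⁻ x, liminf (fun n => ENNReal.ofReal (f n x)) atTop ∂μ := by
          refine lintegral_congr_ae (hlim.mono fun x hx => ?_)
          exact ((ENNReal.continuous_ofReal.tendsto _).comp hx).liminf_eq.symm
      _ ≤ liminf (fun n => ∫⁻ x, ENNReal.ofReal (f n x) ∂μ) atTop :=
          lintegral_liminf_le' fun n => (hf n).aestronglyMeasurable.aemeasurable.ennreal_ofReal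
      _ ≤ ENNReal.ofReal c := by
          refine liminf_le_of_le (by isBoundedDefault) fun b hb' => ?_
          obtain ⟨n, hn⟩ := hb'.exists
          refine hn.trans ?_
          rw [← ofReal_integral_eq_lintegral_ofReal (hf n) (h0 n)]
          exact ENNReal.ofReal_le_ofReal (hb n)
  refine ⟨⟨hm, ?_⟩, ?_⟩
  · rw [hasFiniteIntegral_iff_ofReal hF0]; exact hle.trans_lt ENNReal.ofReal_lt_top
  · rw [integral_eq_lintegral_of_nonneg_ae hF0 hm]
    exact ENNReal.toReal_le_of_le_ofReal hc hle

/-- Functions whose potential energy is at least `c`. -/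
def Admissible (k : ℝ) (h : ℝ → ℝ) (c : ℝ) (P : Lp ℝ 2 (volume : Measure ℝ)) : Prop :=
  IntegrableOn (fun t => primitive h (prim P t) * t ^ (-k)) (Ioi 0) ∧
    c ≤ ∫ t in Ioi 0, primitive h (prim P t) * t ^ (-k)

lemma Admissible.of_tendsto (hh : Nonlinearity k h) (hk : 2 < k) {c R : ℝ}
    {p : ℕ → Lp ℝ 2 (volume : Measure ℝ)} {P : Lp ℝ 2 (volume : Measure ℝ)}
    (hp : ∀ n, Admissible k h c (p n)) (hR : ∀ n, ‖p n‖ ≤ R)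
    (hlim : ∀ t, Tendsto (fun n => prim (p n) t) atTop (𝓝 (prim P t))) : Admissible k h c P := by
  have hR0 : 0 ≤ R := (norm_nonneg _).trans (hR 0)
  obtain ⟨s₀, hs₀, -, hneg⟩ := exists_primitive_nonpos hh
  obtain ⟨τ, hτ, hsmall⟩ : ∃ τ > 0, ∀ t, 0 ≤ t → t < τ → √t * R ≤ s₀ := by
    refine ⟨(s₀ / (R + 1)) ^ 2, by positivity, fun t ht htτ => ?_⟩
    have : √t ≤ s₀ / (R + 1) := (Real.sqrt_le_left (by positivity)).2 htτ.le
    calc √t * R ≤ s₀ / (R + 1) * (R + 1) := by gcongr; linarith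
      _ = s₀ := by field_simp
  set κ := ∫ t in Ioi (0 : ℝ), (Ici τ).indicator (fun t => t ^ (-k)) t with hκ
  have hκi : IntegrableOn ((Ici τ).indicator fun t : ℝ => t ^ (-k)) (Ioi 0) := by
    refine Integrable.integrableOn ((integrable_indicator_iff measurableSet_Ici).2 ?_)
    exact (integrableOn_Ici_iff_integrableOn_Ioi).2 (integrableOn_Ioi_rpow_of_lt (by linarith) hτ)
  set S := R ^ (2 * k - 4) * (4 * R ^ 2) with hS
  have hS0 : 0 ≤ S := by positivity
  have key : ∀ ε > 0, IntegrableOn (fun t => primitive h (prim P t) * t ^ (-k)) (Ioi 0) ∧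
      c - ε * S ≤ ∫ t in Ioi 0, primitive h (prim P t) * t ^ (-k) := by
    intro ε hε
    obtain ⟨C, hC0, hC⟩ := exists_primitive_le hh hk hε
    set g : Lp ℝ 2 (volume : Measure ℝ) → ℝ → ℝ := fun Q t =>
      ε * (|prim Q t| ^ (2 * k - 2) * t ^ (-k)) + C * (Ici τ).indicator (fun t => t ^ (-k)) t with hg
    have hgi : ∀ Q, IntegrableOn (g Q) (Ioi 0) := fun Q =>
      ((integrableOn_prim_rpow hk Q).1.const_mul ε).add (hκi.const_mul C)
    have hgint : ∀ Q, ∫ t in Ioi 0, g Q t =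
        ε * (∫ t in Ioi 0, |prim Q t| ^ (2 * k - 2) * t ^ (-k)) + C * κ := fun Q => by
      rw [hκ, ← integral_const_mul, ← integral_const_mul]
      exact integral_add ((integrableOn_prim_rpow hk Q).1.const_mul ε) (hκi.const_mul C)
    have hfat := integral_le_of_tendsto (μ := volume.restrict (Ioi 0)) (c := ε * S + C * κ - c)
      (f := fun n t => g (p n) t - primitive h (prim (p n) t) * t ^ (-k))
      (F := fun t => g P t - primitive h (prim P t) * t ^ (-k))
      (fun n => (hgi _).sub (hp n).1) (fun n => ?_) (Eventually.of_forall fun t => ?_) fun n => ?_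
    · have hint : IntegrableOn (fun t => primitive h (prim P t) * t ^ (-k)) (Ioi 0) := by
        have := (hgi P).sub hfat.1
        refine this.congr (Eventually.of_forall fun t => ?_)
        simp
      refine ⟨hint, ?_⟩
      have h1 := hfat.2
      rw [integral_sub (hgi P) hint, hgint] at h1
      have h2 : 0 ≤ ∫ t in Ioi (0 : ℝ), |prim P t| ^ (2 * k - 2) * t ^ (-k) :=
        setIntegral_nonneg measurableSet_Ioi fun t ht => by
          have : 0 < t := ht
          positivity
      nlinarith
    · refine (ae_restrict_mem measurableSet_Ioi).mono fun t ht => ?_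
      have ht : 0 < t := ht
      have htk : 0 < t ^ (-k) := Real.rpow_pos_of_pos ht _
      simp only [Pi.zero_apply, hg, sub_nonneg]
      rcases lt_or_ge t τ with hlt | hge
      · have : primitive h (prim (p n) t) ≤ 0 := by
          refine hneg _ ((le_abs_self _).trans ((abs_prim_le _ ht.le).trans ?_))
          exact (mul_le_mul_of_nonneg_left (hR n) (Real.sqrt_nonneg t)).trans (hsmall t ht.le hlt)
        rw [indicator_of_notMem (by simpa using hlt)]
        have h3 : 0 ≤ ε * (|prim (p n) t| ^ (2 * k - 2) * t ^ (-k)) := by positivity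
        nlinarith
      · rw [indicator_of_mem (by simpa using hge)]
        nlinarith [hC (prim (p n) t)]
    · have h1 : Continuous fun s : ℝ => ε * (|s| ^ (2 * k - 2) * t ^ (-k)) +
          C * (Ici τ).indicator (fun t => t ^ (-k)) t - primitive h s * t ^ (-k) := by
        have := continuous_primitive hh.cont
        have h2 : Continuous fun s : ℝ => |s| ^ (2 * k - 2) :=
          (Real.continuous_rpow_const (by linarith)).comp continuous_abs
        fun_prop
      exact (h1.tendsto _).comp (hlim t)
    · rw [integral_sub (hgi _) (hp n).1, hgint]
      have h1 := (integrableOn_prim_rpow hk (p n)).2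
      have h2 : ‖p n‖ ^ (2 * k - 4) * (4 * ‖p n‖ ^ 2) ≤ S := by
        have := Real.rpow_le_rpow (norm_nonneg _) (hR n) (by linarith : 0 ≤ 2 * k - 4)
        have := hR n
        rw [hS]; gcongr
      have h3 := (hp n).2
      nlinarith [mul_le_mul_of_nonneg_left (h1.trans h2) hε.le]
  refine ⟨(key 1 one_pos).1, le_of_forall_pos_le_add fun δ hδ => ?_⟩
  have h1 := (key (δ / (S + 1)) (by positivity)).2
  have h2 : δ / (S + 1) * S ≤ δ := by
    rw [div_mul_eq_mul_div, div_le_iff₀ (by positivity)]; nlinarith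
  linarith

end

section

variable {k : ℝ} {h : ℝ → ℝ}

/-- The indicator function of `(a, b]`. -/
def box (a b : ℝ) : Lp ℝ 2 (volume : Measure ℝ) :=
  indicatorConstLp 2 (measurableSet_Ioc (a := a) (b := b)) measure_Ioc_lt_top.ne (1 : ℝ)

lemma inner_box {a b : ℝ} (ha : 0 ≤ a) (hab : a ≤ b) (P : Lp ℝ 2 (volume : Measure ℝ)) :
    inner ℝ (box a b) P = prim P b - prim P a := (prim_sub_eq_inner P ha hab).symm

lemma prim_box {a : ℝ} (ha : 0 ≤ a) (b t : ℝ) : prim (box a b) t = max (min t b - a) 0 := by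
  rw [prim_eq_inner, box, L2.real_inner_indicatorConstLp_one_indicatorConstLp_one
      measurableSet_Ioc measurableSet_Ioc measure_Ioc_lt_top.ne measure_Ioc_lt_top.ne,
    Ioc_inter_Ioc, Real.volume_real_Ioc, max_eq_right ha]

lemma exists_admissible (hh : Nonlinearity k h) (hk : 2 < k) :
    ∃ c > 0, ∃ P, Admissible k h c P := by
  obtain ⟨ζ, hζ, hpos⟩ := hh.pos
  change 0 < primitive h ζ at hpos
  obtain ⟨M, hM0, hM⟩ := exists_le_primitive hh
  set η := min (1 / 2) (primitive h ζ / (k - 1) / (2 * ((M + 1) * 2 ^ k))) with hη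
  have hk1 : 0 < k - 1 := by linarith
  have hη0 : 0 < η := by positivity
  have hη1 : η ≤ 1 / 2 := min_le_left _ _
  have hη2 : M * 2 ^ k * η < primitive h ζ / (k - 1) := by
    have h1 : η ≤ primitive h ζ / (k - 1) / (2 * ((M + 1) * 2 ^ k)) := min_le_right _ _
    rw [le_div_iff₀ (by positivity)] at h1
    have h2 : 0 < primitive h ζ / (k - 1) := by positivity
    have h3 : (0 : ℝ) < 2 ^ k := by positivity
    nlinarith [mul_pos h3 hη0, mul_nonneg hM0 (mul_pos h3 hη0).le]
  set a := 1 - η with ha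
  have ha0 : 0 < a := by linarith
  have ha1 : a ≤ 1 := by linarith
  set P := (ζ / η) • box a 1 with hP
  have hu : ∀ t, prim P t = ζ / η * max (min t 1 - a) 0 := fun t => by
    rw [hP, prim_smul, prim_box ha0.le]
  set f : ℝ → ℝ := fun t => primitive h (prim P t) * t ^ (-k) with hf
  have hf0 : EqOn f (fun _ => 0) (Ioc 0 a) := fun t ht => by
    simp only [hf]
    rw [hu, min_eq_left (ht.2.trans ha1), max_eq_right (by linarith [ht.2]), mul_zero,
      primitive_zero, zero_mul]
  have hf1 : EqOn f (fun t => primitive h ζ * t ^ (-k)) (Ioi 1) := fun t ht => by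
    simp only [hf]
    rw [hu, min_eq_right (le_of_lt ht), max_eq_left (by linarith),
      show 1 - a = η by rw [ha]; ring, div_mul_cancel₀ _ hη0.ne']
  have hi0 : IntegrableOn f (Ioc 0 a) :=
    (integrableOn_congr_fun hf0 measurableSet_Ioc).2 integrableOn_zero
  have hi1 : IntegrableOn f (Ioi 1) := (integrableOn_congr_fun hf1 measurableSet_Ioi).2
    ((integrableOn_Ioi_rpow_of_lt (by linarith) one_pos).const_mul _)
  have hia : IntegrableOn f (Ioc a 1) := by
    refine (ContinuousOn.integrableOn_Icc ?_).mono_set Ioc_subset_Icc_self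
    refine ((continuous_primitive hh.cont).comp (continuous_prim P)).continuousOn.mul fun t ht => ?_
    exact (Real.continuousAt_rpow_const _ _ (Or.inl (ha0.trans_le ht.1).ne')).continuousWithinAt
  have hsplit : Ioi (0 : ℝ) = Ioc 0 a ∪ (Ioc a 1 ∪ Ioi 1) := by
    rw [Ioc_union_Ioi_eq_Ioi ha1, Ioc_union_Ioi_eq_Ioi ha0.le]
  have hi : IntegrableOn f (Ioi 0) := by rw [hsplit]; exact hi0.union (hia.union hi1)
  have hlow : -(M * 2 ^ k * η) ≤ ∫ t in Ioc a 1, f t := by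
    have h1 : ∫ t in Ioc a 1, -(M * 2 ^ k) ≤ ∫ t in Ioc a 1, f t := by
      refine setIntegral_mono_on (integrableOn_const measure_Ioc_lt_top.ne) hia measurableSet_Ioc fun t ht => ?_
      have ht0 : 0 < t := ha0.trans ht.1
      have h2 : t ^ (-k) ≤ 2 ^ k := by
        rw [Real.rpow_neg ht0.le, ← Real.inv_rpow ht0.le]
        refine Real.rpow_le_rpow (by positivity) ?_ (by linarith)
        rw [inv_le_comm₀ ht0 (by norm_num)]
        linarith [ht.1]
      have h3 := hM (prim P t)
      have h4 : 0 < t ^ (-k) := Real.rpow_pos_of_pos ht0 _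
      simp only [hf]
      nlinarith
    refine le_trans (le_of_eq ?_) h1
    rw [setIntegral_const, Real.volume_real_Ioc_of_le ha1, ha, smul_eq_mul]
    ring
  have hint : ∫ t in Ioi 0, f t = (∫ t in Ioc a 1, f t) + primitive h ζ / (k - 1) := by
    have hd : Disjoint (Ioc 0 a) (Ioc a 1 ∪ Ioi 1) := by
      rw [Ioc_union_Ioi_eq_Ioi ha1]
      exact disjoint_left.2 fun t ht ht' => absurd ht.2 (not_le.2 ht')
    have hd' : Disjoint (Ioc a 1) (Ioi 1) :=
      disjoint_left.2 fun t ht ht' => absurd ht.2 (not_le.2 ht')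
    rw [hsplit, setIntegral_union hd (measurableSet_Ioc.union measurableSet_Ioi) hi0 (hia.union hi1),
      setIntegral_union hd' measurableSet_Ioi hia hi1, setIntegral_congr_fun measurableSet_Ioc hf0,
      setIntegral_congr_fun measurableSet_Ioi hf1, integral_const_mul,
      integral_Ioi_rpow_of_lt (by linarith) one_pos]
    have : -k + 1 ≠ 0 := by linarith
    simp only [integral_zero, Real.one_rpow, zero_add]
    congr 1
    have : k - 1 ≠ 0 := by linarith
    field_simp
    ring
  refine ⟨∫ t in Ioi 0, f t, ?_, P, hi, le_rfl⟩
  rw [hint]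
  linarith

/-- Existence of an element of minimal norm in a weakly sequentially closed set. -/
lemma exists_minimal_norm {E : Type*} [NormedAddCommGroup E] [InnerProductSpace ℝ E]
    [CompleteSpace E] [TopologicalSpace.SeparableSpace E] {S : Set E} (hne : S.Nonempty)
    (hcl : ∀ (p : ℕ → E) (x : E) (R : ℝ), (∀ n, p n ∈ S) → (∀ n, ‖p n‖ ≤ R) →
      (∀ y, Tendsto (fun n => inner ℝ y (p n)) atTop (𝓝 (inner ℝ y x))) → x ∈ S) :
    ∃ x ∈ S, ∀ y ∈ S, ‖x‖ ≤ ‖y‖ := by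
  have hbdd : BddBelow (norm '' S) := ⟨0, by rintro _ ⟨x, -, rfl⟩; exact norm_nonneg x⟩
  set I := sInf (norm '' S) with hI
  have hIle : ∀ y ∈ S, I ≤ ‖y‖ := fun y hy => csInf_le hbdd ⟨y, hy, rfl⟩
  have hex : ∀ n : ℕ, ∃ y ∈ S, ‖y‖ < I + 1 / ((n : ℝ) + 1) := fun n => by
    obtain ⟨_, ⟨y, hy, rfl⟩, hlt⟩ := exists_lt_of_csInf_lt (hne.image norm)
      (lt_add_of_pos_right I (Nat.one_div_pos_of_nat (n := n)))
    exact ⟨y, hy, hlt⟩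
  choose p hpS hplt using hex
  have hbound : ∀ n, ‖p n‖ ≤ I + 1 := fun n => by
    refine (hplt n).le.trans ?_
    have : 1 / ((n : ℝ) + 1) ≤ 1 := by
      rw [div_le_one (by positivity)]; linarith [(Nat.cast_nonneg n : (0 : ℝ) ≤ n)]
    linarith
  have hseq := WeakDual.isSeqCompact_closedBall ℝ E (0 : StrongDual ℝ E) (I + 1)
  obtain ⟨φ, -, σ, hσ, hlim⟩ := hseq
    (x := fun n => StrongDual.toWeakDual (InnerProductSpace.toDual ℝ E (p n))) fun n => by
      simpa using hbound n
  set x := (InnerProductSpace.toDual ℝ E).symm (WeakDual.toStrongDual φ) with hx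
  have hweak : ∀ y, Tendsto (fun n => inner ℝ y (p (σ n))) atTop (𝓝 (inner ℝ y x)) := fun y => by
    have h1 := ((WeakDual.eval_continuous y).tendsto φ).comp hlim
    have h2 : inner ℝ y x = φ y := by
      rw [real_inner_comm, hx, InnerProductSpace.toDual_symm_apply]; rfl
    rw [h2]
    refine h1.congr fun n => ?_
    rw [real_inner_comm]; rfl
  have hxS : x ∈ S := hcl _ x (I + 1) (fun n => hpS _) (fun n => hbound _) hweak
  refine ⟨x, hxS, fun y hy => le_trans ?_ (hIle y hy)⟩
  have hnorm : Tendsto (fun n => ‖x‖ * (I + 1 / ((σ n : ℝ) + 1))) atTop (𝓝 (‖x‖ * (I + 0))) :=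
    ((tendsto_const_nhds.add tendsto_one_div_add_atTop_nhds_zero_nat).comp
      hσ.tendsto_atTop).const_mul _
  have hle := le_of_tendsto_of_tendsto' (hweak x) hnorm fun n =>
    (real_inner_le_norm _ _).trans (mul_le_mul_of_nonneg_left (hplt _).le (norm_nonneg _))
  rw [real_inner_self_eq_norm_mul_norm, add_zero] at hle
  rcases (norm_nonneg x).eq_or_lt with h0 | h0
  · rw [← h0, hI]
    exact le_csInf (hne.image norm) (by rintro _ ⟨y, -, rfl⟩; exact norm_nonneg y)
  · exact le_of_mul_le_mul_left hle h0

lemma exists_minimizer (hh : Nonlinearity k h) (hk : 2 < k) :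
    ∃ c > 0, ∃ P, Admissible k h c P ∧ ∀ Q, Admissible k h c Q → ‖P‖ ≤ ‖Q‖ := by
  obtain ⟨c, hc, P₀, hP₀⟩ := exists_admissible hh hk
  have : Fact ((1 : ℝ≥0∞) ≤ 2) := ⟨by norm_num⟩
  have : Fact ((2 : ℝ≥0∞) ≠ ∞) := ⟨by norm_num⟩
  obtain ⟨P, hP, hmin⟩ := exists_minimal_norm (S := {P | Admissible k h c P}) ⟨P₀, hP₀⟩
    fun p x R hp hR hlim => Admissible.of_tendsto hh hk hp hR fun t => by
      simp only [prim_eq_inner]; exact hlim _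
  exact ⟨c, hc, P, hP, hmin⟩

end

section

variable {k : ℝ} {h : ℝ → ℝ}

/-- Variations whose primitive has compact support in `(0, ∞)`. -/
def IsVariation (q : Lp ℝ 2 (volume : Measure ℝ)) : Prop :=
  ∃ a > 0, ∃ b, ∀ t ∉ Icc a b, prim q t = 0

lemma IsVariation.add {p q : Lp ℝ 2 (volume : Measure ℝ)} (hp : IsVariation p)
    (hq : IsVariation q) : IsVariation (p + q) := by
  obtain ⟨a, ha, b, hab⟩ := hp
  obtain ⟨a', ha', b', hab'⟩ := hq
  refine ⟨min a a', lt_min ha ha', max b b', fun t ht => ?_⟩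
  rw [prim_add, hab t fun h => ht (Icc_subset_Icc (min_le_left _ _) (le_max_left _ _) h),
    hab' t fun h => ht (Icc_subset_Icc (min_le_right _ _) (le_max_right _ _) h), add_zero]

lemma IsVariation.smul {q : Lp ℝ 2 (volume : Measure ℝ)} (hq : IsVariation q) (c : ℝ) :
    IsVariation (c • q) := by
  obtain ⟨a, ha, b, hab⟩ := hq
  exact ⟨a, ha, b, fun t ht => by rw [prim_smul, hab t ht, mul_zero]⟩

lemma integrableOn_of_continuousOn_of_eq_zero {F : ℝ → ℝ} (hF : ContinuousOn F (Ioi 0)) {a b : ℝ}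
    (ha : 0 < a) (h0 : ∀ t ∉ Icc a b, F t = 0) : IntegrableOn F (Ioi 0) := by
  have : F = (Icc a b).indicator F := by
    funext t
    by_cases ht : t ∈ Icc a b
    · rw [indicator_of_mem ht]
    · rw [indicator_of_notMem ht, h0 t ht]
  rw [this]
  exact ((hF.mono fun t ht => ha.trans_le ht.1).integrableOn_Icc.integrable_indicator
    measurableSet_Icc).integrableOn

lemma continuousOn_rpow_neg (k : ℝ) : ContinuousOn (fun t : ℝ => t ^ (-k)) (Ioi 0) := fun _ ht =>
  (Real.continuousAt_rpow_const _ _ (Or.inl (ne_of_gt ht))).continuousWithinAt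

/-- The first variation of the potential energy. -/
def firstVariation (k : ℝ) (h : ℝ → ℝ) (P q : Lp ℝ 2 (volume : Measure ℝ)) : ℝ :=
  ∫ t in Ioi 0, h (prim P t) * prim q t * t ^ (-k)

lemma integrableOn_firstVariation (hc : Continuous h) (P : Lp ℝ 2 (volume : Measure ℝ))
    {q : Lp ℝ 2 (volume : Measure ℝ)} (hq : IsVariation q) :
    IntegrableOn (fun t => h (prim P t) * prim q t * t ^ (-k)) (Ioi 0) := by
  obtain ⟨a, ha, b, hab⟩ := hq
  refine integrableOn_of_continuousOn_of_eq_zero (ContinuousOn.mul ?_ (continuousOn_rpow_neg k)) ha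
    fun t ht => by rw [hab t ht]; simp
  exact ((hc.comp (continuous_prim P)).mul (continuous_prim q)).continuousOn

lemma firstVariation_add (hc : Continuous h) (P : Lp ℝ 2 (volume : Measure ℝ))
    {p q : Lp ℝ 2 (volume : Measure ℝ)} (hp : IsVariation p) (hq : IsVariation q) :
    firstVariation k h P (p + q) = firstVariation k h P p + firstVariation k h P q := by
  rw [firstVariation, firstVariation, firstVariation, ← integral_add
    (integrableOn_firstVariation hc P hp) (integrableOn_firstVariation hc P hq)]
  refine integral_congr_ae (Eventually.of_forall fun t => ?_)
  simp only [prim_add]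
  ring

lemma firstVariation_smul (P q : Lp ℝ 2 (volume : Measure ℝ)) (c : ℝ) :
    firstVariation k h P (c • q) = c * firstVariation k h P q := by
  rw [firstVariation, firstVariation, ← integral_const_mul]
  refine integral_congr_ae (Eventually.of_forall fun t => ?_)
  simp only [prim_smul]
  ring

lemma hasDerivAt_potential (hc : Continuous h) (P q : Lp ℝ 2 (volume : Measure ℝ)) {a b : ℝ}
    (ha : 0 < a) :
    HasDerivAt (fun s => ∫ t in Icc a b, primitive h (prim P t + s * prim q t) * t ^ (-k))
      (∫ t in Icc a b, h (prim P t) * prim q t * t ^ (-k)) 0 := by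
  have hpow : ContinuousOn (fun t : ℝ => t ^ (-k)) (Icc a b) :=
    (continuousOn_rpow_neg k).mono fun t ht => ha.trans_le ht.1
  have hPc := continuous_prim P
  have hqc := continuous_prim q
  have hHc := continuous_primitive hc
  have hF : ∀ s, IntegrableOn (fun t => primitive h (prim P t + s * prim q t) * t ^ (-k))
      (Icc a b) := fun s =>
    ((by fun_prop : Continuous fun t => primitive h (prim P t + s * prim q t)).continuousOn.mul
      hpow).integrableOn_Icc
  have hjoint : ContinuousOn (fun x : ℝ × ℝ => h (prim P x.2 + x.1 * prim q x.2) * prim q x.2 *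
      x.2 ^ (-k)) (Icc (-1) 1 ×ˢ Icc a b) := by
    refine ContinuousOn.mul (by fun_prop) (hpow.comp continuousOn_snd fun x hx => hx.2)
  obtain ⟨M, hM⟩ := (isCompact_Icc.prod isCompact_Icc).exists_bound_of_continuousOn hjoint
  have hnhds : Icc (-1) 1 ∈ 𝓝 (0 : ℝ) := Icc_mem_nhds (by norm_num) (by norm_num)
  have := hasDerivAt_integral_of_dominated_loc_of_deriv_le (μ := volume.restrict (Icc a b))
    (F := fun s t => primitive h (prim P t + s * prim q t) * t ^ (-k))
    (F' := fun s t => h (prim P t + s * prim q t) * prim q t * t ^ (-k)) (x₀ := 0)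
    (bound := fun _ => M) hnhds (Eventually.of_forall fun s => (hF s).aestronglyMeasurable)
    (hF 0) ?_ ?_ (integrableOn_const measure_Icc_lt_top.ne) ?_
  · simpa using this.2
  · have h1 : Continuous fun t => h (prim P t + 0 * prim q t) * prim q t := by fun_prop
    exact (h1.continuousOn.mul hpow).integrableOn_Icc.aestronglyMeasurable
  · exact (ae_restrict_mem measurableSet_Icc).mono fun t ht s hs => hM (s, t) ⟨hs, ht⟩
  · refine Eventually.of_forall fun t s _ => ?_
    have h1 : HasDerivAt (fun s => prim P t + s * prim q t) (prim q t) s := by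
      simpa using ((hasDerivAt_id s).mul_const (prim q t)).const_add (prim P t)
    exact ((hasDerivAt_primitive hc _).comp s h1).mul_const _

lemma exists_admissible_add_smul (hc : Continuous h) {c : ℝ} {P q : Lp ℝ 2 (volume : Measure ℝ)}
    (hP : Admissible k h c P) (hq : IsVariation q) (hpos : 0 < firstVariation k h P q) :
    ∀ᶠ s in 𝓝[>] (0 : ℝ), Admissible k h c (P + s • q) := by
  obtain ⟨a, ha, b, hab⟩ := hq
  have hd := hasDerivAt_potential (k := k) hc P q (b := b) ha
  have hB : ∫ t in Icc a b, h (prim P t) * prim q t * t ^ (-k) = firstVariation k h P q := by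
    rw [firstVariation]
    exact (setIntegral_eq_of_subset_of_forall_sdiff_eq_zero measurableSet_Ioi
      (fun t ht => ha.trans_le ht.1) fun t ht => by rw [hab t ht.2]; simp).symm
  rw [hB, hasDerivAt_iff_tendsto_slope] at hd
  have hev := (hd.mono_left (nhdsWithin_mono 0 fun s (hs : s ∈ Ioi 0) => ne_of_gt hs)).eventually
    (lt_mem_nhds hpos)
  filter_upwards [hev, self_mem_nhdsWithin] with s hs hs0
  have hs0 : 0 < s := hs0
  rw [slope_def_field, sub_zero, lt_div_iff₀ hs0, zero_mul, sub_pos] at hs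
  set D : ℝ → ℝ := fun t => primitive h (prim (P + s • q) t) * t ^ (-k) -
    primitive h (prim P t) * t ^ (-k) with hD
  have hprim : ∀ t, prim (P + s • q) t = prim P t + s * prim q t := fun t => by
    rw [prim_add, prim_smul]
  have hDcont : ContinuousOn D (Ioi 0) :=
    (((continuous_primitive hc).comp (continuous_prim _)).continuousOn.mul
      (continuousOn_rpow_neg k)).sub
    (((continuous_primitive hc).comp (continuous_prim _)).continuousOn.mul
      (continuousOn_rpow_neg k))
  have hD0 : ∀ t ∉ Icc a b, D t = 0 := fun t ht => by
    simp only [hD]; rw [hprim, hab t ht, mul_zero, add_zero, sub_self]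
  have hDi := integrableOn_of_continuousOn_of_eq_zero hDcont ha hD0
  have hsum : (fun t => primitive h (prim (P + s • q) t) * t ^ (-k)) =
      fun t => primitive h (prim P t) * t ^ (-k) + D t := by
    funext t; simp only [hD]; ring
  refine ⟨by rw [hsum]; exact hP.1.add hDi, ?_⟩
  rw [hsum, integral_add hP.1 hDi]
  suffices 0 ≤ ∫ t in Ioi 0, D t by linarith [hP.2]
  rw [setIntegral_eq_of_subset_of_forall_sdiff_eq_zero measurableSet_Ioi
      (fun t (ht : t ∈ Icc a b) => ha.trans_le ht.1) fun t ht => hD0 t ht.2]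
  have hFi : ∀ Q, IntegrableOn (fun t => primitive h (prim Q t) * t ^ (-k)) (Icc a b) := fun Q =>
    (((continuous_primitive hc).comp (continuous_prim Q)).continuousOn.mul
      ((continuousOn_rpow_neg k).mono fun t ht => ha.trans_le ht.1)).integrableOn_Icc
  rw [integral_sub (hFi _) (hFi _), sub_nonneg]
  simpa [hprim] using hs.le

lemma inner_nonneg_of_minimal (hc : Continuous h) {c : ℝ} {P q : Lp ℝ 2 (volume : Measure ℝ)}
    (hP : Admissible k h c P) (hmin : ∀ Q, Admissible k h c Q → ‖P‖ ≤ ‖Q‖)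
    (hq : IsVariation q) (hpos : 0 < firstVariation k h P q) : 0 ≤ (inner ℝ P q : ℝ) := by
  have hev : ∀ᶠ s in 𝓝[>] (0 : ℝ), 0 ≤ 2 * inner ℝ P q + s * ‖q‖ ^ 2 := by
    filter_upwards [exists_admissible_add_smul hc hP hq hpos, self_mem_nhdsWithin] with s hs hs0
    have hs0 : 0 < s := hs0
    have h1 := pow_le_pow_left₀ (norm_nonneg _) (hmin _ hs) 2
    rw [norm_add_sq_real, inner_smul_right, norm_smul, mul_pow, Real.norm_eq_abs, sq_abs] at h1
    refine nonneg_of_mul_nonneg_right (a := s) ?_ hs0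
    nlinarith
  have hlim : Tendsto (fun s : ℝ => 2 * inner ℝ P q + s * ‖q‖ ^ 2) (𝓝[>] 0)
      (𝓝 (2 * inner ℝ P q + 0 * ‖q‖ ^ 2)) := by
    refine Tendsto.mono_left (Continuous.tendsto ?_ 0) nhdsWithin_le_nhds
    fun_prop
  have := ge_of_tendsto hlim hev
  linarith

/-- The Lagrange multiplier rule. -/
lemma exists_multiplier (hc : Continuous h) {c : ℝ} {P q₀ : Lp ℝ 2 (volume : Measure ℝ)}
    (hP : Admissible k h c P) (hmin : ∀ Q, Admissible k h c Q → ‖P‖ ≤ ‖Q‖)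
    (hq₀ : IsVariation q₀) (hne : firstVariation k h P q₀ ≠ 0) :
    ∃ lam ≥ 0, ∀ q, IsVariation q → inner ℝ P q = lam * firstVariation k h P q := by
  set e := (firstVariation k h P q₀)⁻¹ • q₀ with he
  have hev : IsVariation e := hq₀.smul _
  have he1 : firstVariation k h P e = 1 := by rw [he, firstVariation_smul, inv_mul_cancel₀ hne]
  have hle : ∀ q, IsVariation q → firstVariation k h P q * inner ℝ P e ≤ inner ℝ P q := by
    intro q hq
    have h1 : ∀ ε > 0, (firstVariation k h P q - ε) * inner ℝ P e ≤ inner ℝ P q := by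
      intro ε hε
      have h2 := inner_nonneg_of_minimal hc hP hmin
        (hq.add (hev.smul (-(firstVariation k h P q - ε)))) (by
          rw [firstVariation_add hc P hq (hev.smul _), firstVariation_smul, he1]; linarith)
      rw [inner_add_right, inner_smul_right] at h2
      linarith
    have hlim : Tendsto (fun ε : ℝ => (firstVariation k h P q - ε) * inner ℝ P e) (𝓝[>] 0)
        (𝓝 ((firstVariation k h P q - 0) * inner ℝ P e)) := by
      refine Tendsto.mono_left (Continuous.tendsto ?_ 0) nhdsWithin_le_nhds
      fun_prop
    rw [sub_zero] at hlim
    exact le_of_tendsto hlim (eventually_nhdsWithin_of_forall fun ε hε => h1 ε hε)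
  refine ⟨inner ℝ P e, inner_nonneg_of_minimal hc hP hmin hev (by rw [he1]; exact one_pos),
    fun q hq => le_antisymm ?_ ?_⟩
  · have h3 := hle _ (hq.smul (-1))
    rw [firstVariation_smul, inner_smul_right P q] at h3
    linarith
  · rw [mul_comm]; exact hle q hq

end

section

variable {k : ℝ} {h : ℝ → ℝ}

/-- Every continuous function on `(0, ∞)` has a second primitive. -/
lemma exists_second_primitive {f : ℝ → ℝ} (hf : ContinuousOn f (Ioi 0)) :
    ∃ W W' : ℝ → ℝ, (∀ t > 0, HasDerivAt W (W' t) t) ∧ ∀ t > 0, HasDerivAt W' (f t) t := by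
  have key : ∀ g : ℝ → ℝ, ContinuousOn g (Ioi 0) →
      ∀ t > 0, HasDerivAt (fun t => ∫ s in (1 : ℝ)..t, g s) (g t) t := fun g hg t ht => by
    refine intervalIntegral.integral_hasDerivAt_right ?_ ?_ (hg.continuousAt (Ioi_mem_nhds ht))
    · refine (hg.mono fun s hs => ?_).intervalIntegrable
      exact (lt_min one_pos ht).trans_le hs.1
    · exact hg.stronglyMeasurableAtFilter isOpen_Ioi t ht
  exact ⟨_, _, key _ fun t ht => (key f hf t ht).continuousAt.continuousWithinAt, key f hf⟩

/-- A function all of whose second divided differences vanish is affine. -/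
lemma exists_eq_affine {D : ℝ → ℝ} (hD : ∀ x y z, 0 < x → x < y → y < z →
    (z - y) * (D y - D x) = (y - x) * (D z - D y)) : ∃ α β : ℝ, ∀ t > 0, D t = α + β * t := by
  refine ⟨D 1 - (D 2 - D 1), D 2 - D 1, fun t ht => ?_⟩
  rcases lt_trichotomy t 1 with h1 | rfl | h1
  · linarith [hD t 1 2 ht h1 (by norm_num)]
  · ring
  rcases lt_trichotomy t 2 with h2 | rfl | h2
  · linarith [hD 1 t 2 one_pos h1 h2]
  · ring
  · linarith [hD 1 2 t one_pos (by norm_num) h2]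

/-- The derivative of an (unnormalised) hat function. -/
def hat (x y z : ℝ) : Lp ℝ 2 (volume : Measure ℝ) := (z - y) • box x y - (y - x) • box y z

lemma inner_hat {x y z : ℝ} (hx : 0 < x) (hxy : x < y) (hyz : y < z)
    (P : Lp ℝ 2 (volume : Measure ℝ)) : inner ℝ P (hat x y z) =
      (z - y) * (prim P y - prim P x) - (y - x) * (prim P z - prim P y) := by
  rw [real_inner_comm, hat, inner_sub_left, real_inner_smul_left, real_inner_smul_left,
    inner_box hx.le hxy.le, inner_box (hx.trans hxy).le hyz.le]

lemma prim_hat {x y z : ℝ} (hx : 0 < x) (hxy : x < y) (t : ℝ) :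
    prim (hat x y z) t =
      (z - y) * max (min t y - x) 0 - (y - x) * max (min t z - y) 0 := by
  rw [hat, sub_eq_add_neg, ← neg_smul, prim_add, prim_smul, prim_smul, prim_box hx.le,
    prim_box (hx.trans hxy).le]
  ring

lemma prim_hat_eq_zero {x y z : ℝ} (hx : 0 < x) (hxy : x < y) (hyz : y < z) {t : ℝ}
    (ht : t ∉ Icc x z) : prim (hat x y z) t = 0 := by
  rw [prim_hat hx hxy]
  rcases lt_or_ge t x with h1 | h1
  · rw [min_eq_left (h1.trans hxy).le, min_eq_left (h1.trans (hxy.trans hyz)).le,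
      max_eq_right (by linarith), max_eq_right (by linarith)]
    ring
  · have h2 : z < t := not_le.1 fun h => ht ⟨h1, h⟩
    rw [min_eq_right (hyz.trans h2).le, min_eq_right h2.le, max_eq_left (by linarith),
      max_eq_left (by linarith)]
    ring

lemma isVariation_hat {x y z : ℝ} (hx : 0 < x) (hxy : x < y) (hyz : y < z) :
    IsVariation (hat x y z) := ⟨x, hx, z, fun _ ht => prim_hat_eq_zero hx hxy hyz ht⟩

lemma firstVariation_hat (hc : Continuous h) (P : Lp ℝ 2 (volume : Measure ℝ)) {W W' : ℝ → ℝ}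
    (hW : ∀ t > 0, HasDerivAt W (W' t) t)
    (hW' : ∀ t > 0, HasDerivAt W' (-(t ^ (-k) * h (prim P t))) t)
    {x y z : ℝ} (hx : 0 < x) (hxy : x < y) (hyz : y < z) :
    firstVariation k h P (hat x y z) = (z - y) * (W y - W x) - (y - x) * (W z - W y) := by
  set φ := prim (hat x y z) with hφ
  set F : ℝ → ℝ := fun t => h (prim P t) * φ t * t ^ (-k) with hF
  have hFc : ContinuousOn F (Ioi 0) :=
    ((hc.comp (continuous_prim P)).mul (continuous_prim _)).continuousOn.mul
      (continuousOn_rpow_neg k)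
  have hy : 0 < y := hx.trans hxy
  have hint : ∀ a b, 0 < a → a ≤ b → IntervalIntegrable F volume a b := fun a b ha hab =>
    (hFc.mono fun t ht => ha.trans_le (uIcc_of_le hab ▸ ht).1).intervalIntegrable
  have h1 : firstVariation k h P (hat x y z) = (∫ t in x..y, F t) + ∫ t in y..z, F t := by
    rw [intervalIntegral.integral_add_adjacent_intervals (hint x y hx hxy.le) (hint y z hy hyz.le),
      intervalIntegral.integral_of_le (hxy.trans hyz).le, ← integral_Icc_eq_integral_Ioc]
    exact setIntegral_eq_of_subset_of_forall_sdiff_eq_zero measurableSet_Ioi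
      (fun t ht => hx.trans_le ht.1) fun t ht => by
        rw [prim_hat_eq_zero hx hxy hyz ht.2]; simp
  have h2 : ∫ t in x..y, F t = -((z - y) * (W' y * (y - x) - W y)) -
      -((z - y) * (W' x * (x - x) - W x)) := by
    refine intervalIntegral.integral_eq_sub_of_hasDerivAt
      (f := fun t => -((z - y) * (W' t * (t - x) - W t))) (fun t ht => ?_) (hint x y hx hxy.le)
    rw [uIcc_of_le hxy.le] at ht
    have ht0 : 0 < t := hx.trans_le ht.1
    refine ((((hW' t ht0).fun_mul ((hasDerivAt_id t).sub_const x)).fun_sub (hW t ht0)).const_mul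
      (z - y)).fun_neg.congr_deriv ?_
    simp only [hF, hφ]
    rw [prim_hat hx hxy, min_eq_left ht.2, max_eq_left (by linarith [ht.1]),
      min_eq_left (ht.2.trans hyz.le), max_eq_right (by linarith [ht.2])]
    simp only [id]
    ring
  have h3 : ∫ t in y..z, F t = -((y - x) * (W' z * (z - z) + W z)) -
      -((y - x) * (W' y * (z - y) + W y)) := by
    refine intervalIntegral.integral_eq_sub_of_hasDerivAt
      (f := fun t => -((y - x) * (W' t * (z - t) + W t))) (fun t ht => ?_) (hint y z hy hyz.le)
    rw [uIcc_of_le hyz.le] at ht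
    have ht0 : 0 < t := hy.trans_le ht.1
    refine ((((hW' t ht0).fun_mul ((hasDerivAt_id t).const_sub z)).fun_add (hW t ht0)).const_mul
      (y - x)).fun_neg.congr_deriv ?_
    simp only [hF, hφ]
    rw [prim_hat hx hxy, min_eq_right ht.1, max_eq_left (by linarith),
      min_eq_left ht.2, max_eq_left (by linarith [ht.1])]
    simp only [id]
    ring
  rw [h1, h2, h3]
  ring

/-- Existence of a solution, with an unspecified Lagrange multiplier. -/
theorem exists_solution (hh : Nonlinearity k h) (hk : 2 < k) :
    ∃ lam > 0, ∃ u u' : ℝ → ℝ, Solution k lam h u u' := by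
  obtain ⟨c, hc, P, hP, hmin⟩ := exists_minimizer hh hk
  set u := prim P with hu
  have huc : Continuous u := continuous_prim P
  obtain ⟨s₀, hs₀, hhs₀, hneg⟩ := exists_primitive_nonpos hh
  obtain ⟨T, hT0, hT⟩ : ∃ T > 0, 0 < primitive h (u T) := by
    by_contra! hcon
    have : ∫ t in Ioi 0, primitive h (prim P t) * t ^ (-k) ≤ 0 :=
      setIntegral_nonpos measurableSet_Ioi fun t ht =>
        mul_nonpos_of_nonpos_of_nonneg (hcon t ht) (Real.rpow_nonneg (le_of_lt ht) _)
    linarith [hP.2]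
  have hs₀T : s₀ < u T := not_le.1 fun h => absurd (hneg _ h) (not_le.2 hT)
  obtain ⟨W, W', hW, hW'⟩ := exists_second_primitive (f := fun t => -(t ^ (-k) * h (u t)))
    ((continuousOn_rpow_neg k).mul (hh.cont.comp huc).continuousOn).neg
  have hfv : ∀ x y z, 0 < x → x < y → y < z → firstVariation k h P (hat x y z) =
      (z - y) * (W y - W x) - (y - x) * (W z - W y) := fun x y z hx hxy hyz =>
    firstVariation_hat hh.cont P hW hW' hx hxy hyz
  obtain ⟨q₀, hq₀, hne⟩ : ∃ q, IsVariation q ∧ firstVariation k h P q ≠ 0 := by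
    by_contra! hcon
    obtain ⟨α, β, hWaff⟩ := exists_eq_affine (D := W) fun x y z hx hxy hyz => by
      have := hcon _ (isVariation_hat hx hxy hyz)
      rw [hfv x y z hx hxy hyz] at this
      linarith
    have hW'c : ∀ t > 0, W' t = β := fun t ht => by
      refine (hW t ht).unique ?_
      have h1 : HasDerivAt (fun t => α + β * t) β t := by
        simpa using ((hasDerivAt_id t).const_mul β).const_add α
      exact h1.congr_of_eventuallyEq ((eventually_gt_nhds ht).mono fun s hs => hWaff s hs)
    have hh0 : ∀ t > 0, h (u t) = 0 := fun t ht => by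
      have h1 := (hW' t ht).unique ((hasDerivAt_const t β).congr_of_eventuallyEq
        ((eventually_gt_nhds ht).mono fun s hs => hW'c s hs))
      simpa [(Real.rpow_pos_of_pos ht (-k)).ne'] using h1
    obtain ⟨t, ht, hut⟩ := intermediate_value_Icc hT0.le huc.continuousOn
      (show s₀ ∈ Icc (u 0) (u T) from ⟨by rw [hu, prim_of_nonpos P le_rfl]; exact hs₀.le, hs₀T.le⟩)
    have ht0 : 0 < t := ht.1.lt_of_ne fun h0 => by
      rw [← h0, hu, prim_of_nonpos P le_rfl] at hut; exact hs₀.ne hut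
    have := hh0 t ht0
    rw [hut] at this
    exact hhs₀.ne this
  obtain ⟨lam, hlam, hmult⟩ := exists_multiplier hh.cont hP hmin hq₀ hne
  obtain ⟨α, β, haff⟩ := exists_eq_affine (D := fun t => u t - lam * W t) fun x y z hx hxy hyz => by
    have h1 := hmult _ (isVariation_hat hx hxy hyz)
    rw [hfv x y z hx hxy hyz, inner_hat hx hxy hyz] at h1
    simp only [hu]
    linear_combination h1
  have hbound : ∀ t > 0, |u t| ≤ ‖P‖ * √t := fun t ht => by
    rw [mul_comm]; exact abs_prim_le P ht.le
  have hlam0 : 0 < lam := by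
    refine hlam.lt_of_ne fun h0 => ?_
    have haff' : ∀ t > 0, u t = α + β * t := fun t ht => by simpa [← h0] using haff t ht
    have hβ : β = 0 := by
      by_contra hβ
      obtain ⟨t, -, ht0, hlt⟩ := exists_sqrt_lt_linear (abs_pos.2 hβ) ‖P‖ |α| 0
      have h1 := hbound t ht0
      rw [haff' t ht0] at h1
      have h2 : |β| * t ≤ |α + β * t| + |α| := by
        rw [← abs_of_pos ht0, ← abs_mul, abs_of_pos ht0]
        calc |β * t| = |(α + β * t) - α| := by ring_nf
          _ ≤ _ := abs_sub _ _
      linarith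
    have hα : α = 0 := by
      have h1 : Tendsto u (𝓝[>] 0) (𝓝 (u 0)) := huc.continuousWithinAt
      have h2 : Tendsto u (𝓝[>] 0) (𝓝 α) := tendsto_const_nhds.congr'
        (eventually_nhdsWithin_of_forall fun t ht => by rw [haff' t ht, hβ]; ring)
      rw [← tendsto_nhds_unique h1 h2, hu, prim_of_nonpos P le_rfl]
    have h3 : u T = 0 := by rw [haff' T hT0, hα, hβ]; ring
    linarith
  have hueq : ∀ t > 0, u t = α + β * t + lam * W t := fun t ht => by linarith [haff t ht]
  refine ⟨lam, hlam0, u, fun t => β + lam * W' t, prim_of_nonpos P le_rfl, fun t ht => ?_,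
    fun t ht => ?_, ⟨‖P‖, hbound⟩, T, hT0, (hs₀.trans hs₀T).ne'⟩
  · have h1 : HasDerivAt (fun t => α + β * t + lam * W t) (β + lam * W' t) t := by
      simpa using (((hasDerivAt_id t).const_mul β).const_add α).fun_add ((hW t ht).const_mul lam)
    exact h1.congr_of_eventuallyEq ((eventually_gt_nhds ht).mono fun s hs => hueq s hs)
  · refine (((hW' t ht).const_mul lam).const_add β).congr_deriv ?_
    ring

/-- The multiplier can be normalised by a change of variables. -/
theorem exists_solution_of_pos (hh : Nonlinearity k h) (hk : 2 < k) {Λ : ℝ} (hΛ : 0 < Λ) :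
    ∃ u u' : ℝ → ℝ, Solution k Λ h u u' := by
  obtain ⟨lam, hlam, u, u', hs⟩ := exists_solution hh hk
  have hk2 : k - 2 ≠ 0 := by linarith
  set c := (lam / Λ) ^ (1 / (k - 2)) with hc
  have hc0 : 0 < c := by positivity
  have hck : c * c * (lam * c ^ (-k)) = Λ := by
    have h1 : c ^ (k - 2) = lam / Λ := by
      rw [hc, ← Real.rpow_mul (by positivity), one_div, inv_mul_cancel₀ hk2, Real.rpow_one]
    have h2 : c ^ (-k) = (c ^ (k - 2))⁻¹ * (c ^ (2 : ℝ))⁻¹ := by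
      rw [← Real.rpow_neg hc0.le, ← Real.rpow_neg hc0.le, ← Real.rpow_add hc0]
      congr 1; ring
    rw [h2, h1, Real.rpow_two]
    field_simp
  have hmul : ∀ t, HasDerivAt (fun t => c * t) c t := fun t => by
    simpa using (hasDerivAt_id t).const_mul c
  obtain ⟨C, hC⟩ := hs.bound
  obtain ⟨T, hT, hne⟩ := hs.nontrivial
  refine ⟨fun t => u (c * t), fun t => c * u' (c * t), by simpa using hs.zero, fun t ht => ?_,
    fun t ht => ?_, ⟨C * √c, fun t ht => ?_⟩, T / c, by positivity, ?_⟩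
  · refine ((hs.deriv (c * t) (by positivity)).comp t (hmul t)).congr_deriv ?_
    ring
  · refine (((hs.deriv' (c * t) (by positivity)).comp t (hmul t)).const_mul c).congr_deriv ?_
    rw [Real.mul_rpow hc0.le ht.le, ← hck]
    ring
  · refine (hC (c * t) (by positivity)).trans (le_of_eq ?_)
    rw [Real.sqrt_mul hc0.le]; ring
  · simpa [mul_div_cancel₀ _ hc0.ne'] using hne

end

lemma exists_linear_bounds {g : ℝ → ℝ} (hg0 : g 0 = 0) {m : ℝ} (hm : 0 < m)
    (hliminf : (⊥ : EReal) < liminf (fun s : ℝ => ((g s / s : ℝ) : EReal)) (𝓝[>] 0))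
    (hlimsup : limsup (fun s : ℝ => ((g s / s : ℝ) : EReal)) (𝓝[>] 0) = ((-m : ℝ) : EReal)) :
    ∃ s₀ > 0, ∃ c > 0, ∃ K, ∀ s, 0 ≤ s → s ≤ s₀ → -(K * s) ≤ g s ∧ g s ≤ -(c * s) := by
  obtain ⟨a, -, ha⟩ := EReal.lt_iff_exists_real_btwn.1 hliminf
  have h1 := eventually_lt_of_lt_liminf ha
  have h2 : ∀ᶠ s in 𝓝[>] (0 : ℝ), ((g s / s : ℝ) : EReal) < ((-(m / 2) : ℝ) : EReal) :=
    eventually_lt_of_limsup_lt (by rw [hlimsup, EReal.coe_lt_coe_iff]; linarith)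
  obtain ⟨δ, hδ, hsub⟩ := mem_nhdsGT_iff_exists_Ioo_subset.1 (h1.and h2)
  have hδ : 0 < δ := hδ
  refine ⟨δ / 2, by positivity, m / 2, by positivity, -a, fun s hs0 hs => ?_⟩
  rcases hs0.eq_or_lt with rfl | hs0
  · simp [hg0]
  · obtain ⟨e1, e2⟩ := hsub (show s ∈ Ioo 0 δ from ⟨hs0, by linarith⟩)
    rw [EReal.coe_lt_coe_iff] at e1 e2
    rw [lt_div_iff₀ hs0] at e1
    rw [div_lt_iff₀ hs0] at e2
    constructor <;> linarith

lemma exists_growth_bound {g : ℝ → ℝ} (hc : Continuous g) {l : ℝ}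
    (hinfty : limsup (fun s : ℝ => ((g s / s ^ l : ℝ) : EReal)) atTop ≤ 0) {ε : ℝ} (hε : 0 < ε) :
    ∃ C, ∀ s, 0 ≤ s → g s ≤ ε * s ^ l + C := by
  have h1 : ∀ᶠ s : ℝ in atTop, ((g s / s ^ l : ℝ) : EReal) < (ε : EReal) :=
    eventually_lt_of_limsup_lt (hinfty.trans_lt (by exact_mod_cast hε))
  obtain ⟨S, hS⟩ := eventually_atTop.1 (h1.and (eventually_gt_atTop 0))
  obtain ⟨M, hM⟩ := (isCompact_Icc (a := 0) (b := S)).exists_bound_of_continuousOn hc.continuousOn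
  refine ⟨|M|, fun s hs0 => ?_⟩
  rcases le_total s S with hs | hs
  · have := (le_abs_self _).trans (hM s ⟨hs0, hs⟩)
    have h2 : 0 ≤ ε * s ^ l := by positivity
    linarith [le_abs_self M]
  · obtain ⟨e1, e2⟩ := hS s hs
    rw [EReal.coe_lt_coe_iff, div_lt_iff₀ (by positivity)] at e1
    linarith [abs_nonneg M]

/-- Truncation of the nonlinearity: the maximum principle makes solutions of the truncated problem
solutions of the original one. -/
lemma exists_nonlinearity {g : ℝ → ℝ} (hc : Continuous g) (hg0 : g 0 = 0) {k m : ℝ}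
    (hm : 0 < m)
    (hliminf : (⊥ : EReal) < liminf (fun s : ℝ => ((g s / s : ℝ) : EReal)) (𝓝[>] 0))
    (hlimsup : limsup (fun s : ℝ => ((g s / s : ℝ) : EReal)) (𝓝[>] 0) = ((-m : ℝ) : EReal))
    (hinfty : limsup (fun s : ℝ => ((g s / s ^ (2 * k - 3) : ℝ) : EReal)) atTop ≤ 0)
    (hG : ∃ ζ : ℝ, 0 < ζ ∧ 0 < ∫ σ in (0 : ℝ)..ζ, g σ) :
    ∃ h, Nonlinearity k h ∧ ∀ lam > 0, ∀ u u', Solution k lam h u u' →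
      ∀ t ≥ 0, h (u t) = g (u t) := by
  obtain ⟨s₀, hs₀, c, hc0, K, hnear⟩ := exists_linear_bounds hg0 hm hliminf hlimsup
  obtain ⟨ζ, hζ, hpos⟩ := hG
  by_cases hcase : ∃ s₂ ≥ ζ, g s₂ ≤ 0
  · obtain ⟨s₂, hs₂, hgs₂⟩ := hcase
    have hs₂0 : 0 < s₂ := hζ.trans_le hs₂
    set h : ℝ → ℝ := fun s => g (max 0 (min s s₂)) * (1 - max 0 (min 1 (s - s₂))) with hh
    have heq : ∀ s, 0 ≤ s → s ≤ s₂ → h s = g s := fun s h0 h1 => by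
      simp only [hh]
      rw [min_eq_left h1, max_eq_right h0, max_eq_left ((min_le_right _ _).trans (by linarith))]
      ring
    have hcut : ∀ s, 0 ≤ 1 - max 0 (min 1 (s - s₂)) ∧ 1 - max 0 (min 1 (s - s₂)) ≤ 1 := fun s =>
      ⟨sub_nonneg.2 (max_le zero_le_one (min_le_left _ _)), by linarith [le_max_left 0 (min 1 (s - s₂))]⟩
    have habove : ∀ s ≥ s₂, h s ≤ 0 := fun s hs => by
      simp only [hh]
      rw [min_eq_right hs, max_eq_right hs₂0.le]
      exact mul_nonpos_of_nonpos_of_nonneg hgs₂ (hcut s).1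
    have hnon : Nonlinearity k h := by
      refine ⟨by fun_prop, fun s hs => ?_, ?_, fun ε hε => ?_, ⟨s₂ + 1, fun s hs => ?_⟩, ζ, hζ, ?_⟩
      · simp only [hh]
        rw [max_eq_left ((min_le_left _ _).trans hs), hg0, zero_mul]
      · refine ⟨min s₀ s₂, lt_min hs₀ hs₂0, c, hc0, K, fun s h0 h1 => ?_⟩
        rw [heq s h0 (h1.trans (min_le_right _ _))]
        exact hnear s h0 (h1.trans (min_le_left _ _))
      · obtain ⟨M, hM⟩ := (isCompact_Icc (a := 0) (b := s₂)).exists_bound_of_continuousOn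
          hc.continuousOn
        refine ⟨M, fun s hs => ?_⟩
        have h1 : h s ≤ M := by
          refine (le_abs_self _).trans ?_
          simp only [hh]
          rw [abs_mul, abs_of_nonneg (hcut s).1]
          have h2 := hM (max 0 (min s s₂)) ⟨le_max_left _ _, max_le hs₂0.le (min_le_right _ _)⟩
          rw [Real.norm_eq_abs] at h2
          exact (mul_le_of_le_one_right (abs_nonneg _) (hcut s).2).trans h2
        have h3 : 0 ≤ ε * s ^ (2 * k - 3) := by positivity
        linarith
      · simp only [hh]
        rw [min_eq_left (by linarith : 1 ≤ s - s₂), max_eq_right zero_le_one, sub_self, mul_zero]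
      · rwa [intervalIntegral.integral_congr (g := g)]
        intro σ hσ
        rw [uIcc_of_le hζ.le] at hσ
        exact heq σ hσ.1 (hσ.2.trans hs₂)
    refine ⟨h, hnon, fun lam hlam u u' hs t ht => ?_⟩
    exact heq _ (hs.nonneg hnon t ht) (hs.le_of_nonpos_above hlam hs₂0.le habove t ht)
  · push Not at hcase
    have heq : ∀ s, 0 ≤ s → g (max 0 s) = g s := fun s hs => by rw [max_eq_right hs]
    have hnon : Nonlinearity k fun s => g (max 0 s) := by
      refine ⟨by fun_prop, fun s hs => by rw [max_eq_left hs, hg0],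
        ⟨s₀, hs₀, c, hc0, K, fun s h0 h1 => by rw [heq s h0]; exact hnear s h0 h1⟩,
        fun ε hε => ?_, ⟨ζ, fun s hs => ?_⟩, ζ, hζ, ?_⟩
      · obtain ⟨C, hC⟩ := exists_growth_bound hc hinfty hε
        exact ⟨C, fun s hs => by rw [heq s hs]; exact hC s hs⟩
      · rw [heq s (hζ.le.trans hs)]; exact (hcase s hs).le
      · rwa [intervalIntegral.integral_congr (g := g)]
        intro σ hσ
        rw [uIcc_of_le hζ.le] at hσ
        exact heq σ hσ.1
    exact ⟨_, hnon, fun lam hlam u u' hs t ht => heq _ (hs.nonneg hnon t ht)⟩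

section

set_option maxSynthPendingDepth 3

lemma tendsto_norm_nhdsGE_zero {E : Type*} [NormedAddCommGroup E] :
    Tendsto (fun x : E => ‖x‖) (𝓝 0) (𝓝[≥] 0) :=
  tendsto_nhdsWithin_iff.2 ⟨by simpa using (continuous_norm (E := E)).tendsto 0,
    Eventually.of_forall fun x => norm_nonneg x⟩

variable {E : Type*} [NormedAddCommGroup E] [InnerProductSpace ℝ E]

/-- The real inner product as a linear map into the dual. -/
def innerDual : E →L[ℝ] E →L[ℝ] ℝ := innerSL ℝ

lemma innerDual_apply (x y : E) : innerDual x y = inner ℝ x y := rfl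

lemma norm_innerDual (x : E) : ‖innerDual x‖ = ‖x‖ := innerSL_apply_norm ℝ x

lemma norm_innerDual_le : ‖(innerDual : E →L[ℝ] E →L[ℝ] ℝ)‖ ≤ 1 :=
  ContinuousLinearMap.opNorm_le_bound _ zero_le_one fun x => by rw [norm_innerDual, one_mul]

lemma hasFDerivAt_norm {x : E} (hx : x ≠ 0) :
    HasFDerivAt (fun x : E => ‖x‖) (‖x‖⁻¹ • innerDual x) x := by
  have h := (hasStrictFDerivAt_norm_sq x).hasFDerivAt.sqrt (pow_ne_zero 2 (norm_ne_zero_iff.2 hx))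
  simp only [Real.sqrt_sq (norm_nonneg _)] at h
  refine h.congr_fderiv ?_
  ext y
  change 1 / (2 * ‖x‖) * (2 • inner ℝ x y) = ‖x‖⁻¹ * inner ℝ x y
  rw [nsmul_eq_mul]
  have := norm_ne_zero_iff.2 hx
  push_cast
  field_simp

lemma hasFDerivAt_comp_norm {w ψ : ℝ → ℝ} (hw : ∀ r > 0, HasDerivAt w (r * ψ r) r)
    (hw0 : ContinuousWithinAt w (Ici 0) 0) (hψ : ContinuousOn ψ (Ici 0)) (x : E) :
    HasFDerivAt (fun x => w ‖x‖) (ψ ‖x‖ • innerDual x) x := by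
  rcases eq_or_ne x 0 with rfl | hx
  · have h1 : HasDerivWithinAt w 0 (Ici 0) 0 := by
      refine hasDerivWithinAt_Ici_of_tendsto_deriv (s := Ioi 0)
        (fun r hr => (hw r hr).differentiableAt.differentiableWithinAt)
        (hw0.mono Ioi_subset_Ici_self) self_mem_nhdsWithin ?_
      have h2 : Tendsto (fun r => r * ψ r) (𝓝[>] 0) (𝓝 (0 * ψ 0)) :=
        (tendsto_nhdsWithin_of_tendsto_nhds tendsto_id).mul
          ((hψ 0 self_mem_Ici).mono Ioi_subset_Ici_self)
      rw [zero_mul] at h2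
      exact h2.congr' (eventually_nhdsWithin_of_forall fun r hr => (hw r hr).deriv.symm)
    rw [hasDerivWithinAt_iff_isLittleO] at h1
    rw [norm_zero, map_zero, smul_zero, hasFDerivAt_iff_isLittleO]
    have h4 := h1.comp_tendsto (tendsto_norm_nhdsGE_zero (E := E))
    refine Asymptotics.IsLittleO.of_norm_right ?_
    simpa [Function.comp_def] using h4
  · have hr : 0 < ‖x‖ := norm_pos_iff.2 hx
    refine ((hw _ hr).comp_hasFDerivAt x (hasFDerivAt_norm hx)).congr_fderiv ?_
    rw [smul_smul]
    congr 1
    field_simp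

/-- The derivative of `x ↦ ψ(|x|) ⟨x, ·⟩` when `r ψ'(r) = χ(r)`. -/
def radialHessian (ψ χ : ℝ → ℝ) (x : E) : E →L[ℝ] E →L[ℝ] ℝ :=
  ψ ‖x‖ • innerDual + (χ ‖x‖ / ‖x‖ ^ 2) • (innerDual x).smulRight (innerDual x)

lemma norm_div_sq_smul_le (a : ℝ) (x : E) :
    ‖(a / ‖x‖ ^ 2) • (innerDual x).smulRight (innerDual x : E →L[ℝ] ℝ)‖ ≤ |a| := by
  refine (ContinuousLinearMap.opNorm_smul_le (a / ‖x‖ ^ 2) ((innerDual x).smulRight (innerDual x : E →L[ℝ] ℝ))).trans ?_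
  rw [ContinuousLinearMap.norm_smulRight_apply, norm_innerDual, Real.norm_eq_abs,
    abs_div, abs_of_nonneg (sq_nonneg ‖x‖), ← sq]
  rcases eq_or_ne x 0 with rfl | hx
  · simp
  · have := norm_ne_zero_iff.2 hx
    rw [div_mul_cancel₀ _ (pow_ne_zero 2 this)]

lemma norm_radialHessian_le (ψ χ : ℝ → ℝ) (x : E) :
    ‖radialHessian ψ χ x‖ ≤ |ψ ‖x‖| + |χ ‖x‖| := by
  have h1 : ‖ψ ‖x‖ • (innerDual : E →L[ℝ] E →L[ℝ] ℝ)‖ ≤ |ψ ‖x‖| :=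
    (ContinuousLinearMap.opNorm_smul_le _ _).trans (mul_le_of_le_one_right (abs_nonneg _) norm_innerDual_le)
  have h2 := norm_div_sq_smul_le (χ ‖x‖) x
  exact (ContinuousLinearMap.opNorm_add_le _ _).trans (add_le_add h1 h2)

lemma hasFDerivAt_smul_innerDual {ψ χ : ℝ → ℝ} (hψ' : ∀ r > 0, HasDerivAt ψ (χ r / r) r)
    (hψ : ContinuousOn ψ (Ici 0)) (x : E) :
    HasFDerivAt (fun x => ψ ‖x‖ • (innerDual x : E →L[ℝ] ℝ)) (radialHessian ψ χ x) x := by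
  rcases eq_or_ne x 0 with rfl | hx
  · have h0 : Tendsto (fun x : E => ψ ‖x‖ - ψ 0) (𝓝 0) (𝓝 0) := by
      have := (hψ 0 self_mem_Ici).tendsto.comp (tendsto_norm_nhdsGE_zero (E := E))
      simpa [Function.comp_def] using this.sub_const (ψ 0)
    rw [hasFDerivAt_iff_isLittleO]
    have h1 : (fun x : E => (ψ ‖x‖ - ψ 0) • innerDual x) =o[𝓝 0] fun x : E => x := by
      have h2 : (fun x : E => ψ ‖x‖ - ψ 0) =o[𝓝 0] fun _ => (1 : ℝ) :=
        (Asymptotics.isLittleO_one_iff ℝ).2 h0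
      have h3 : (fun x : E => innerDual x) =O[𝓝 0] fun x : E => x :=
        Asymptotics.isBigO_of_le _ fun x => (norm_innerDual x).le
      refine Asymptotics.IsLittleO.of_norm_right ?_
      simpa using h2.smul_isBigO h3.norm_right
    refine (h1.congr_left fun y => ?_).congr_right fun y => (sub_zero y).symm
    simp only [radialHessian, norm_zero, map_zero, smul_zero, sub_zero]
    ext z
    simp [sub_mul]
  · have hr : 0 < ‖x‖ := norm_pos_iff.2 hx
    refine (((hψ' _ hr).comp_hasFDerivAt x (hasFDerivAt_norm hx)).smul
      (innerDual (E := E)).hasFDerivAt).congr_fderiv ?_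
    ext y z
    simp [radialHessian]
    field_simp

lemma continuous_radialHessian {ψ χ : ℝ → ℝ} (hψ : ContinuousOn ψ (Ici 0))
    (hχ : ContinuousOn χ (Ici 0)) (hχ0 : χ 0 = 0) :
    Continuous (radialHessian ψ χ : E → E →L[ℝ] E →L[ℝ] ℝ) := by
  have hψn : Continuous fun x : E => ψ ‖x‖ :=
    hψ.comp_continuous continuous_norm fun x => norm_nonneg x
  have hχn : Continuous fun x : E => χ ‖x‖ :=
    hχ.comp_continuous continuous_norm fun x => norm_nonneg x
  have h1 : Continuous fun x : E => ψ ‖x‖ • (innerDual : E →L[ℝ] E →L[ℝ] ℝ) :=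
    hψn.smul continuous_const
  refine h1.add (continuous_iff_continuousAt.2 fun x => ?_)
  rcases eq_or_ne x 0 with rfl | hx
  · unfold ContinuousAt
    simp only [norm_zero, hχ0, zero_div, zero_smul]
    refine squeeze_zero_norm (fun y => norm_div_sq_smul_le _ y) ?_
    simpa [hχ0] using hχn.abs.tendsto 0
  · refine (hχn.continuousAt.div (continuous_norm.pow 2).continuousAt
      (pow_ne_zero 2 (norm_ne_zero_iff.2 hx))).smul ?_
    have : Continuous fun x : E => ((innerDual x).smulRight (innerDual x) :
        E →L[ℝ] E →L[ℝ] ℝ) := by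
      have h1 := isBoundedBilinearMap_smulRight (𝕜 := ℝ) (E := E) (F := E →L[ℝ] ℝ)
      have := h1.continuous.comp
        ((innerDual (E := E)).continuous.prodMk (innerDual (E := E)).continuous)
      exact this
    exact this.continuousAt

/-- Data `w, ψ, χ` with `w' = r ψ` and `r ψ' = χ`, describing a radial `C²` function. -/
structure RadialData (w ψ χ : ℝ → ℝ) : Prop where
  deriv : ∀ r > 0, HasDerivAt w (r * ψ r) r
  deriv' : ∀ r > 0, HasDerivAt ψ (χ r / r) r
  cont : ContinuousWithinAt w (Ici 0) 0
  cont' : ContinuousOn ψ (Ici 0)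
  cont'' : ContinuousOn χ (Ici 0)
  zero : χ 0 = 0

namespace RadialData
variable {w ψ χ : ℝ → ℝ}

lemma fderiv_eq (hR : RadialData w ψ χ) :
    fderiv ℝ (fun x : E => w ‖x‖) = fun x => ψ ‖x‖ • innerDual x :=
  funext fun x => (hasFDerivAt_comp_norm hR.deriv hR.cont hR.cont' x).fderiv

lemma fderiv_fderiv_eq (hR : RadialData w ψ χ) :
    fderiv ℝ (fderiv ℝ (fun x : E => w ‖x‖)) = radialHessian ψ χ := by
  rw [hR.fderiv_eq]
  exact funext fun x => (hasFDerivAt_smul_innerDual hR.deriv' hR.cont' x).fderiv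

lemma contDiff (hR : RadialData w ψ χ) : ContDiff ℝ 2 (fun x : E => w ‖x‖) := by
  refine (contDiff_succ_iff_hasFDerivAt (n := 1)).2
    ⟨_, contDiff_one_iff_hasFDerivAt.2 ⟨_, continuous_radialHessian hR.cont' hR.cont'' hR.zero,
      hasFDerivAt_smul_innerDual hR.deriv' hR.cont'⟩,
      hasFDerivAt_comp_norm hR.deriv hR.cont hR.cont'⟩

lemma norm_iteratedFDeriv_one_eq (hR : RadialData w ψ χ) (x : E) :
    ‖iteratedFDeriv ℝ 1 (fun x : E => w ‖x‖) x‖ = |ψ ‖x‖| * ‖x‖ := by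
  rw [norm_iteratedFDeriv_one, hR.fderiv_eq, norm_smul, norm_innerDual, Real.norm_eq_abs]

lemma norm_iteratedFDeriv_two_le (hR : RadialData w ψ χ) (x : E) :
    ‖iteratedFDeriv ℝ 2 (fun x : E => w ‖x‖) x‖ ≤ |ψ ‖x‖| + |χ ‖x‖| := by
  rw [← norm_iteratedFDeriv_fderiv, norm_iteratedFDeriv_one, hR.fderiv_fderiv_eq]
  exact norm_radialHessian_le _ _ _

end RadialData

end

lemma RadialData.lap_eq {w ψ χ : ℝ → ℝ} (hR : RadialData w ψ χ) (d : ℕ) (x : Ed d) :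
    lap d (fun x => w ‖x‖) x = d * ψ ‖x‖ + χ ‖x‖ := by
  have h1 : ∀ i : Fin d, fderiv ℝ (fun y : Ed d => fderiv ℝ (fun x : Ed d => w ‖x‖) y
      (EuclideanSpace.single i 1)) x (EuclideanSpace.single i 1)
      = ψ ‖x‖ + χ ‖x‖ / ‖x‖ ^ 2 * x i ^ 2 := by
    intro i
    rw [hR.fderiv_eq]
    have := (hasFDerivAt_smul_innerDual hR.deriv' hR.cont' x).clm_apply
      (hasFDerivAt_const (EuclideanSpace.single i (1 : ℝ)) x)
    rw [this.fderiv]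
    have hin : inner ℝ x (EuclideanSpace.single i (1 : ℝ)) = x i := by
      simp [EuclideanSpace.inner_single_right]
    simp [radialHessian, innerDual_apply, hin, sq]
  unfold lap
  simp only [h1]
  rw [Finset.sum_add_distrib, ← Finset.mul_sum, ← EuclideanSpace.real_norm_sq_eq]
  simp only [Finset.sum_const, Finset.card_univ, Fintype.card_fin, nsmul_eq_mul]
  rcases eq_or_ne x 0 with rfl | hx
  · simp [hR.zero]
  · rw [div_mul_cancel₀ _ (pow_ne_zero 2 (norm_ne_zero_iff.2 hx))]

/-- A continuous-at-the-origin solution of `w'' + (d-1)/r w' = -f` with `r^(d-1) w' → 0`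
is radial data. -/
lemma exists_radialData {w w' f : ℝ → ℝ} {d : ℕ} (hd : 1 ≤ d)
    (hw : ∀ r > 0, HasDerivAt w (w' r) r)
    (hw' : ∀ r > 0, HasDerivAt (fun r => r ^ (d - 1) * w' r) (-(r ^ (d - 1) * f r)) r)
    (hw0 : ContinuousWithinAt w (Ici 0) 0)
    (h0 : Tendsto (fun r => r ^ (d - 1) * w' r) (𝓝[>] 0) (𝓝 0))
    (hf : ContinuousOn f (Ici 0)) :
    ∃ ψ χ, RadialData w ψ χ ∧ (∀ r > 0, r * ψ r = w' r) ∧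
      ∀ r ≥ 0, d * ψ r + χ r = -f r := by
  have hdR : (0 : ℝ) < d := by exact_mod_cast hd
  let ψ : ℝ → ℝ := fun r => if r = 0 then -f 0 / d else w' r / r
  let χ : ℝ → ℝ := fun r => -f r - d * ψ r
  have hψ0 : ψ 0 = -f 0 / d := if_pos rfl
  have hψr : ∀ r > 0, ψ r = w' r / r := fun r hr => if_neg hr.ne'
  have hψF : ∀ r > 0, ψ r = r ^ (d - 1) * w' r / r ^ d := by
    intro r hr
    rw [hψr r hr]
    obtain ⟨e, rfl⟩ : ∃ e, d = e + 1 := ⟨d - 1, by omega⟩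
    simp only [Nat.add_sub_cancel]
    field_simp
    ring
  have hψ' : ∀ r > 0, HasDerivAt ψ (χ r / r) r := by
    intro r hr
    have h1 := (hw' r hr).fun_div (hasDerivAt_pow d r) (pow_pos hr d).ne'
    have h2 : HasDerivAt ψ _ r := h1.congr_of_eventuallyEq
      ((eventually_gt_nhds hr).mono fun s hs => hψF s hs)
    refine h2.congr_deriv ?_
    simp only [χ]
    rw [hψF r hr]
    obtain ⟨e, rfl⟩ : ∃ e, d = e + 1 := ⟨d - 1, by omega⟩
    simp only [Nat.add_sub_cancel]
    push_cast
    field_simp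
    ring
  have hψc0 : Tendsto ψ (𝓝[>] 0) (𝓝 (-f 0 / d)) := by
    have h1 : Tendsto (fun r => r ^ (d - 1) * w' r / r ^ d) (𝓝[>] 0) (𝓝 (-f 0 / d)) := by
      refine HasDerivAt.lhopital_zero_nhdsGT
        (f' := fun r => -(r ^ (d - 1) * f r)) (g' := fun r => d * r ^ (d - 1))
        (eventually_nhdsWithin_of_forall fun r hr => hw' r hr)
        (eventually_nhdsWithin_of_forall fun r hr => hasDerivAt_pow d r)
        (eventually_nhdsWithin_of_forall fun r (hr : 0 < r) => by positivity) h0 ?_ ?_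
      · have : Tendsto (fun r : ℝ => r ^ d) (𝓝 0) (𝓝 (0 ^ d)) :=
          (continuous_pow d).tendsto 0
        rw [zero_pow (by omega)] at this
        exact this.mono_left nhdsWithin_le_nhds
      · have h2 : Tendsto (fun r => -f r / d) (𝓝[>] 0) (𝓝 (-f 0 / d)) :=
          ((hf 0 self_mem_Ici).mono Ioi_subset_Ici_self).tendsto.neg.div_const _
        refine h2.congr' (eventually_nhdsWithin_of_forall fun r (hr : 0 < r) => ?_)
        field_simp
    exact h1.congr' (eventually_nhdsWithin_of_forall fun r hr => (hψF r hr).symm)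
  have hψc : ContinuousOn ψ (Ici 0) := by
    intro r hr
    rcases (mem_Ici.1 hr).eq_or_lt with rfl | hr
    · rw [← continuousWithinAt_Ioi_iff_Ici]
      unfold ContinuousWithinAt
      rwa [hψ0]
    · exact (hψ' r hr).continuousAt.continuousWithinAt
  refine ⟨ψ, χ, ⟨?_, hψ', hw0, hψc, hf.neg.sub (continuousOn_const.mul hψc), ?_⟩, ?_, ?_⟩
  · intro r hr
    refine (hw r hr).congr_deriv ?_
    rw [hψr r hr]
    field_simp
  · simp only [χ, hψ0]
    field_simp
    ring
  · intro r hr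
    rw [hψr r hr]
    field_simp
  · intro r hr
    simp only [χ]
    ring

section

variable {k lam : ℝ} {h u u' : ℝ → ℝ}

lemma Solution.exists_limit (hs : Solution k lam h u u') (hh : Nonlinearity k h) (hk : 2 < k)
    (hlam : 0 < lam) : ∃ W, Tendsto u atTop (𝓝 W) ∧ ∀ t ≥ 0, u t ≤ W := by
  obtain ⟨B, -, hB⟩ := hs.bounded hh hk hlam
  have hm := hs.monotoneOn hh hk hlam
  have h1 : Monotone fun t => u (max 0 t) := fun s t hst =>
    hm (mem_Ici.2 (le_max_left 0 s)) (mem_Ici.2 (le_max_left 0 t)) (max_le_max_left _ hst)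
  have h2 : BddAbove (range fun t => u (max 0 t)) :=
    ⟨B, by rintro _ ⟨t, rfl⟩; exact hB _ (le_max_left _ _)⟩
  refine ⟨_, (tendsto_atTop_ciSup h1 h2).congr' ?_, fun t ht => ?_⟩
  · filter_upwards [eventually_ge_atTop 0] with t ht
    rw [max_eq_right ht]
  · have := le_ciSup h2 t
    rwa [max_eq_right ht] at this

/-- The radial profile `r ↦ u (r^(-n))`, extended by `W` at the origin. -/
def profile (u : ℝ → ℝ) (W n r : ℝ) : ℝ := if r = 0 then W else u (r ^ (-n))

lemma profile_zero (W n : ℝ) : profile u W n 0 = W := if_pos rfl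

lemma profile_of_pos (W n : ℝ) {r : ℝ} (hr : 0 < r) : profile u W n r = u (r ^ (-n)) :=
  if_neg hr.ne'

lemma continuousWithinAt_profile {W n : ℝ} (hn : 0 < n) (hW : Tendsto u atTop (𝓝 W)) :
    ContinuousWithinAt (profile u W n) (Ici 0) 0 := by
  rw [← continuousWithinAt_Ioi_iff_Ici]
  unfold ContinuousWithinAt
  rw [profile_zero]
  exact (hW.comp (tendsto_rpow_neg_nhdsGT_zero (neg_neg_of_pos hn))).congr'
    (eventually_nhdsWithin_of_forall fun r hr => (profile_of_pos W n hr).symm)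

lemma antitoneOn_profile {W n : ℝ} (hn : 0 ≤ n) (hu : MonotoneOn u (Ici 0))
    (hW : ∀ t ≥ 0, u t ≤ W) : AntitoneOn (profile u W n) (Ici 0) := by
  intro r hr s hs hrs
  rcases (mem_Ici.1 hr).eq_or_lt with rfl | hr
  · rw [profile_zero]
    rcases (mem_Ici.1 hs).eq_or_lt with rfl | hs
    · rw [profile_zero]
    · rw [profile_of_pos _ _ hs]
      exact hW _ (Real.rpow_nonneg hs.le _)
  · have hs := hr.trans_le hrs
    rw [profile_of_pos _ _ hs, profile_of_pos _ _ hr]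
    exact hu (Real.rpow_nonneg hs.le _) (Real.rpow_nonneg hr.le _)
      (Real.rpow_le_rpow_of_nonpos hr hrs (by linarith))

lemma Solution.hasDerivAt_profile (hs : Solution k lam h u u') (W n : ℝ) {r : ℝ} (hr : 0 < r) :
    HasDerivAt (profile u W n) (-(n * r ^ (-n - 1) * u' (r ^ (-n)))) r := by
  have h1 := (hs.deriv _ (Real.rpow_pos_of_pos hr (-n))).comp r
    (Real.hasDerivAt_rpow_const (p := -n) (Or.inl hr.ne'))
  refine (h1.congr_of_eventuallyEq
    ((eventually_gt_nhds hr).mono fun s hs => profile_of_pos W n hs)).congr_deriv ?_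
  ring

lemma rpow_mul_profile_deriv {d : ℕ} (hd : 2 ≤ d) {r : ℝ} (hr : 0 < r) (a : ℝ) :
    r ^ (d - 1) * -(((d : ℝ) - 2) * r ^ (-((d : ℝ) - 2) - 1) * a) = -(((d : ℝ) - 2) * a) := by
  have : r ^ (-((d : ℝ) - 2) - 1) = (r ^ (d - 1))⁻¹ := by
    rw [← Real.rpow_natCast, ← Real.rpow_neg hr.le, Nat.cast_sub (by omega)]
    congr 1
    push_cast
    ring
  rw [this]
  have := (pow_pos hr (d - 1)).ne'
  field_simp

lemma Solution.hasDerivAt_flux {d : ℕ} (hd : 3 ≤ d)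
    (hs : Solution (2 * ((d : ℝ) - 1) / (d - 2)) (1 / ((d : ℝ) - 2) ^ 2) h u u') (W : ℝ)
    {r : ℝ} (hr : 0 < r) :
    HasDerivAt (fun r => r ^ (d - 1) * -(((d : ℝ) - 2) * r ^ (-((d : ℝ) - 2) - 1) *
      u' (r ^ (-((d : ℝ) - 2))))) (-(r ^ (d - 1) * h (profile u W (d - 2) r))) r := by
  have hn : (0 : ℝ) < d - 2 := by
    have : (3 : ℝ) ≤ d := by exact_mod_cast hd
    linarith
  have h1 := (((hs.deriv' _ (Real.rpow_pos_of_pos hr (-((d : ℝ) - 2)))).comp r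
    (Real.hasDerivAt_rpow_const (p := -((d : ℝ) - 2)) (Or.inl hr.ne'))).const_mul
      ((d : ℝ) - 2)).fun_neg
  refine (h1.congr_of_eventuallyEq ((eventually_gt_nhds hr).mono fun s hs =>
    rpow_mul_profile_deriv (by omega) hs _)).congr_deriv ?_
  have h2 : (r ^ (-((d : ℝ) - 2))) ^ (-(2 * ((d : ℝ) - 1) / (d - 2)))
      * r ^ (-((d : ℝ) - 2) - 1) = r ^ (d - 1) := by
    rw [← Real.rpow_mul hr.le, ← Real.rpow_add hr, ← Real.rpow_natCast, Nat.cast_sub (by omega)]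
    congr 1
    push_cast
    field_simp
    ring
  rw [profile_of_pos _ _ hr, ← h2]
  field_simp

/-- Exponential decay of the data entering the derivatives of a radial function. -/
lemma Solution.exists_radial_decay {d : ℕ} (hd : 3 ≤ d)
    (hs : Solution (2 * ((d : ℝ) - 1) / (d - 2)) (1 / ((d : ℝ) - 2) ^ 2) h u u')
    (hh : Nonlinearity (2 * ((d : ℝ) - 1) / (d - 2)) h) (W : ℝ) :
    ∃ C, ∃ b > 0, ∀ᶠ r in atTop, profile u W (d - 2) r ≤ C * Real.exp (-(b * r)) ∧
      |-(((d : ℝ) - 2) * r ^ (-((d : ℝ) - 2) - 1) * u' (r ^ (-((d : ℝ) - 2))))|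
        ≤ C * Real.exp (-(b * r)) ∧
      |h (profile u W (d - 2) r)| ≤ C * Real.exp (-(b * r)) := by
  have hn : (0 : ℝ) < d - 2 := by
    have : (3 : ℝ) ≤ d := by exact_mod_cast hd
    linarith
  set n : ℝ := (d : ℝ) - 2 with hn_def
  have hk : 2 < 2 * ((d : ℝ) - 1) / n := by
    rw [lt_div_iff₀ hn]; linarith
  have hlam : 0 < 1 / n ^ 2 := by positivity
  obtain ⟨C, hC, b, hb, τ, hτ, hdec⟩ := hs.exists_exp_decay hh hk hlam
  obtain ⟨s₀, hs₀, c, hc, K, hnear⟩ := hh.near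
  have hexp : Tendsto (fun r => C * Real.exp (-(b * r))) atTop (𝓝 0) := by
    have : Tendsto (fun r => Real.exp (-(b * r))) atTop (𝓝 0) :=
      Real.tendsto_exp_neg_atTop_nhds_zero.comp (tendsto_id.const_mul_atTop hb)
    simpa using this.const_mul C
  have ht := tendsto_rpow_neg_atTop hn
  refine ⟨(1 + n + |K|) * C, b, hb, ?_⟩
  filter_upwards [eventually_ge_atTop 1, hexp.eventually_le_const hs₀,
    ht.eventually_le_const hτ] with r hr hrs hrt
  have hr0 : 0 < r := by linarith
  have htp : 0 < r ^ (-n) := Real.rpow_pos_of_pos hr0 _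
  have hpow : (r ^ (-n)) ^ (1 - 2 * ((d : ℝ) - 1) / n / 2) = r := by
    rw [← Real.rpow_mul hr0.le]
    have : -n * (1 - 2 * ((d : ℝ) - 1) / n / 2) = 1 := by
      field_simp
      rw [hn_def]
      ring
    rw [this, Real.rpow_one]
  obtain ⟨h1, h2⟩ := hdec _ htp hrt
  rw [hpow] at h1 h2
  have hu0 := hs.nonneg hh _ htp.le
  have hu'0 := hs.deriv_nonneg hh hk hlam _ htp
  have hCe : 0 ≤ C * Real.exp (-(b * r)) := by positivity
  rw [profile_of_pos _ _ hr0]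
  have hK := abs_nonneg K
  refine ⟨?_, ?_, ?_⟩
  · nlinarith [mul_nonneg hn.le hCe, mul_nonneg hK hCe]
  · have h3 : r ^ (-n - 1) ≤ r ^ (-n) := Real.rpow_le_rpow_of_exponent_le hr (by linarith)
    have h4 : 0 ≤ r ^ (-n - 1) := Real.rpow_nonneg hr0.le _
    rw [abs_neg, abs_of_nonneg (by positivity)]
    have h5 : r ^ (-n - 1) * u' (r ^ (-n)) ≤ C * Real.exp (-(b * r)) :=
      (mul_le_mul_of_nonneg_right h3 hu'0).trans (by linarith)
    have := mul_le_mul_of_nonneg_left h5 hn.le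
    nlinarith [mul_nonneg hK hCe]
  · obtain ⟨h3, h4⟩ := hnear _ hu0 (h1.trans hrs)
    have h5 : |h (u (r ^ (-n)))| ≤ |K| * u (r ^ (-n)) := by
      rw [abs_le]
      have := mul_le_mul_of_nonneg_right (le_abs_self K) hu0
      exact ⟨by linarith, by nlinarith [mul_nonneg hK hu0, mul_nonneg hc.le hu0]⟩
    have := mul_le_mul_of_nonneg_left h1 hK
    nlinarith [mul_nonneg hn.le hCe]

lemma exists_forall_le_exp {E : Type*} [NormedAddCommGroup E] [ProperSpace E] {F : E → ℝ}
    (hF : Continuous F) {C b : ℝ} (h : ∀ᶠ r in atTop, ∀ x : E, ‖x‖ = r →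
      F x ≤ C * Real.exp (-(b * r))) :
    ∃ M, ∀ x, F x ≤ M * Real.exp (-(b * ‖x‖)) := by
  obtain ⟨R, hR⟩ := eventually_atTop.1 h
  have hG : Continuous fun x => F x * Real.exp (b * ‖x‖) := by fun_prop
  obtain ⟨M, hM⟩ := (isCompact_closedBall (0 : E) R).bddAbove_image hG.continuousOn
  have hinv : ∀ x : E, Real.exp (b * ‖x‖) * Real.exp (-(b * ‖x‖)) = 1 := fun x => by
    rw [← Real.exp_add, add_neg_cancel, Real.exp_zero]
  refine ⟨max M C, fun x => ?_⟩
  rcases le_total ‖x‖ R with hx | hx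
  · have h1 : F x * Real.exp (b * ‖x‖) ≤ M := hM ⟨x, by simpa using hx, rfl⟩
    have h2 := mul_le_mul_of_nonneg_right (h1.trans (le_max_left M C))
      (Real.exp_pos (-(b * ‖x‖))).le
    rwa [mul_assoc, hinv, mul_one] at h2
  · exact (hR _ hx x rfl).trans
      (mul_le_mul_of_nonneg_right (le_max_right M C) (Real.exp_pos _).le)

end

end BerestyckiLions

open BerestyckiLions Set Topology

/-- Berestycki–Lions existence theorem. Let `d ≥ 3` and `g : ℝ → ℝ` be odd,
continuous, `g(0) = 0`, with: `-∞ < liminf_{s→0⁺} g(s)/s ≤ limsup_{s→0⁺} g(s)/s = -m < 0`;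
`limsup_{s→+∞} g(s)/s^l ≤ 0` with `l = (d+2)/(d-2)`; and `G(ζ) = ∫₀^ζ g > 0` for some `ζ > 0`.
Then the problem `-Δv = g(v)` has a nontrivial solution `v` which is positive, spherically
symmetric and radially decreasing, of class `C²`, with exponential decay of all derivatives
up to order `2`. -/
theorem berestycki_lions
    (d : ℕ) (hd : 3 ≤ d) (g : ℝ → ℝ)
    (hodd : ∀ s : ℝ, g (-s) = -g s) (hcont : Continuous g) (hg0 : g 0 = 0)
    (m : ℝ) (hm : 0 < m)
    (hliminf : (⊥ : EReal) <
      Filter.liminf (fun s : ℝ => ((g s / s : ℝ) : EReal)) (nhdsWithin 0 (Set.Ioi 0)))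
    (hlimsup : Filter.limsup (fun s : ℝ => ((g s / s : ℝ) : EReal)) (nhdsWithin 0 (Set.Ioi 0))
      = ((-m : ℝ) : EReal))
    (hinfty : Filter.limsup
        (fun s : ℝ => ((g s / s ^ (((d : ℝ) + 2) / ((d : ℝ) - 2)) : ℝ) : EReal)) Filter.atTop
      ≤ (0 : EReal))
    (hG : ∃ ζ : ℝ, 0 < ζ ∧ 0 < ∫ σ in (0:ℝ)..ζ, g σ) :
    ∃ v : Ed d → ℝ,
      (∀ x, 0 < v x) ∧
      (∃ w : ℝ → ℝ, AntitoneOn w (Set.Ici 0) ∧ ∀ x, v x = w ‖x‖) ∧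
      ContDiff ℝ 2 v ∧
      (∀ x, -lap d v x = g (v x)) ∧
      (∃ C : ℝ, 0 < C ∧ ∃ δ : ℝ, 0 < δ ∧
        ∀ n : ℕ, n ≤ 2 → ∀ x, ‖iteratedFDeriv ℝ n v x‖ ≤ C * Real.exp (-δ * ‖x‖)) := by
  have hd3 : (3 : ℝ) ≤ d := by exact_mod_cast hd
  have hn : (0 : ℝ) < d - 2 := by linarith
  have hk : 2 < 2 * ((d : ℝ) - 1) / (d - 2) := by rw [lt_div_iff₀ hn]; linarith
  have hexp : ((d : ℝ) + 2) / (d - 2) = 2 * (2 * ((d : ℝ) - 1) / (d - 2)) - 3 := by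
    field_simp
    ring
  rw [hexp] at hinfty
  obtain ⟨h, hh, hhg⟩ := exists_nonlinearity hcont hg0 hm hliminf hlimsup hinfty hG
  have hlam : 0 < 1 / ((d : ℝ) - 2) ^ 2 := by positivity
  obtain ⟨u, u', hs⟩ := exists_solution_of_pos hh hk hlam
  obtain ⟨W, hW, hWle⟩ := hs.exists_limit hh hk hlam
  have hmono := hs.monotoneOn hh hk hlam
  set w := profile u W (d - 2) with hw_def
  have hanti : AntitoneOn w (Ici 0) := antitoneOn_profile hn.le hmono hWle
  have hwc0 : ContinuousWithinAt w (Ici 0) 0 := continuousWithinAt_profile hn hW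
  have hwc : ContinuousOn w (Ici 0) := fun r hr => by
    rcases (mem_Ici.1 hr).eq_or_lt with rfl | hr
    · exact hwc0
    · exact (hs.hasDerivAt_profile W _ hr).continuousAt.continuousWithinAt
  have hwpos : ∀ r ≥ 0, 0 < w r := fun r hr => by
    rcases hr.eq_or_lt with rfl | hr
    · rw [hw_def, profile_zero]
      exact (hs.pos hh hk hlam 1 one_pos).trans_le (hWle 1 zero_le_one)
    · rw [hw_def, profile_of_pos _ _ hr]
      exact hs.pos hh hk hlam _ (Real.rpow_pos_of_pos hr _)
  have hwg : ∀ r ≥ 0, h (w r) = g (w r) := fun r hr => by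
    rcases hr.eq_or_lt with rfl | hr
    · rw [hw_def, profile_zero]
      refine tendsto_nhds_unique ((hh.cont.tendsto W).comp hW)
        (((hcont.tendsto W).comp hW).congr' ?_)
      filter_upwards [eventually_ge_atTop 0] with t ht
      exact (hhg _ hlam u u' hs t ht).symm
    · rw [hw_def, profile_of_pos _ _ hr]
      exact hhg _ hlam u u' hs _ (Real.rpow_nonneg hr.le _)
  have hflux : Tendsto (fun r => r ^ (d - 1) * -(((d : ℝ) - 2) * r ^ (-((d : ℝ) - 2) - 1) *
      u' (r ^ (-((d : ℝ) - 2))))) (𝓝[>] 0) (𝓝 0) := by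
    have h1 := (((hs.tendsto_deriv_atTop hh hk hlam).comp
      (tendsto_rpow_neg_nhdsGT_zero (neg_neg_of_pos hn))).const_mul ((d : ℝ) - 2)).neg
    rw [mul_zero, neg_zero] at h1
    exact h1.congr' (eventually_nhdsWithin_of_forall fun r hr =>
      (rpow_mul_profile_deriv (by omega) hr _).symm)
  obtain ⟨ψ, χ, hR, hψ, hψχ⟩ := exists_radialData (by omega)
    (fun r hr => hs.hasDerivAt_profile W _ hr) (fun r hr => hs.hasDerivAt_flux hd W hr) hwc0 hflux
    (hh.cont.comp_continuousOn hwc)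
  obtain ⟨C, b, hb, hdec⟩ := hs.exists_radial_decay hd hh W
  have hC2 := hR.contDiff (E := Ed d)
  have hbound : ∀ n ≤ 2, ∃ M, ∀ x : Ed d,
      ‖iteratedFDeriv ℝ n (fun x => w ‖x‖) x‖ ≤ M * Real.exp (-(b * ‖x‖)) := by
    intro n hn2
    refine exists_forall_le_exp (C := (2 * d + 2) * |C|)
      (hC2.continuous_iteratedFDeriv (by exact_mod_cast hn2)).norm ?_
    filter_upwards [hdec, eventually_ge_atTop 1] with r hr hr1 x hx
    subst hx
    obtain ⟨h1, h2, h3⟩ := hr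
    rw [← hψ _ (by linarith)] at h2
    have hx0 : (0 : ℝ) ≤ ‖x‖ := norm_nonneg x
    have hCe : C * Real.exp (-(b * ‖x‖)) ≤ |C| * Real.exp (-(b * ‖x‖)) :=
      mul_le_mul_of_nonneg_right (le_abs_self C) (Real.exp_pos _).le
    set D := |C| * Real.exp (-(b * ‖x‖)) with hD
    have hD0 : 0 ≤ D := by positivity
    have hdD : 0 ≤ (d : ℝ) * D := by positivity
    rw [abs_mul, abs_of_nonneg hx0] at h2
    have hψD : |ψ ‖x‖| ≤ D := by nlinarith [abs_nonneg (ψ ‖x‖)]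
    rw [mul_assoc, ← hD]
    interval_cases n
    · rw [norm_iteratedFDeriv_zero, Real.norm_eq_abs, abs_of_pos (hwpos _ hx0)]
      linarith
    · rw [hR.norm_iteratedFDeriv_one_eq]
      linarith
    · refine (hR.norm_iteratedFDeriv_two_le x).trans ?_
      have h4 : χ ‖x‖ = -h (w ‖x‖) - d * ψ ‖x‖ := by
        have := hψχ _ hx0
        rw [← hw_def] at this
        linarith
      have h5 : |χ ‖x‖| ≤ |h (w ‖x‖)| + d * |ψ ‖x‖| := by
        rw [h4]
        refine (abs_sub _ _).trans_eq ?_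
        rw [abs_neg, abs_mul, Nat.abs_cast]
      nlinarith [mul_le_mul_of_nonneg_left hψD (Nat.cast_nonneg (α := ℝ) d)]
  choose! M hM using hbound
  refine ⟨fun x => w ‖x‖, fun x => hwpos _ (norm_nonneg x), ⟨w, hanti, fun x => rfl⟩, hC2,
    fun x => ?_, |M 0| + |M 1| + |M 2| + 1, by positivity, b, hb, fun n hn2 x => ?_⟩
  · rw [hR.lap_eq, hψχ _ (norm_nonneg x), neg_neg]
    exact hwg _ (norm_nonneg x)
  · refine (hM n hn2 x).trans ?_
    rw [neg_mul]
    refine mul_le_mul_of_nonneg_right ?_ (Real.exp_pos _).le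
    have h0 := le_abs_self (M n)
    have := abs_nonneg (M 0)
    have := abs_nonneg (M 1)
    have := abs_nonneg (M 2)
    interval_cases n <;> linarith
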